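/- arXiv:1602.06560 — 2 statements merged into one kernel-verified Lean document; each statement's English description precedes it below -/
import Mathlib

section
/- Grünbaum's conjecture: for every convex body K in ℝ^n and every x ∈ ℝ^n fixed by all affine symmetries of K (i.e., gx = x whenever g ∈ Aff(n) satisfies gK = K), there exists an affine invariant point p : K_n → ℝ^n with p(K) = x. Hence P_n(K) = F_n(K) for all K ∈ K_n. -/
open Metric Set Pointwise

noncomputable section

abbrev En (n : ℕ) : Type := EuclideanSpace ℝ (Fin n)

abbrev AffG (n : ℕ) : Type := En n ≃ᵃ[ℝ] En n

abbrev KBody (n : ℕ) : Type :=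
  {K : ConvexBody (En n) // (interior (K : Set (En n))).Nonempty}

instance (n : ℕ) : SMul (AffG n) (KBody n) where
  smul g K :=
    ⟨⟨g '' (K.1 : Set (En n)),
      K.1.convex.affine_image g.toAffineMap,
      K.1.isCompact.image g.continuous_of_finiteDimensional,
      K.1.nonempty.image g⟩,
      by
        obtain ⟨x, hx⟩ := K.2
        refine ⟨g x, ?_⟩
        show g x ∈ interior (⇑g '' (K.1 : Set (En n)))
        rw [← g.coe_toHomeomorphOfFiniteDimensional,
          ← Homeomorph.image_interior]
        exact ⟨x, hx, rfl⟩⟩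

theorem smul_body_coe {n : ℕ} (g : AffG n) (K : KBody n) :
    ((g • K : KBody n).1 : Set (En n)) = g '' (K.1 : Set (En n)) := rfl

instance (n : ℕ) : MulAction (AffG n) (KBody n) where
  one_smul K := by
    apply Subtype.ext; apply ConvexBody.ext
    rw [smul_body_coe]; simp
  mul_smul g h K := by
    apply Subtype.ext; apply ConvexBody.ext
    rw [smul_body_coe, smul_body_coe, smul_body_coe, Set.image_image]
    simp [AffineEquiv.mul_def]

/-- An affine invariant point. -/
def IsAffineInvariantPoint {n : ℕ} (p : KBody n → En n) : Prop :=
  Continuous p ∧ ∀ (g : AffG n) (K : KBody n), p (g • K) = g (p K)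

/-- The set `F_n(K)` of points fixed by every affine symmetry of `K`. -/
def Fn {n : ℕ} (K : KBody n) : Set (En n) :=
  {x | ∀ g : AffG n, g • K = K → g x = x}

/-- The set `P_n(K)` of values of affine invariant points at `K`. -/
def Pn {n : ℕ} (K : KBody n) : Set (En n) :=
  {x | ∃ p : KBody n → En n, IsAffineInvariantPoint p ∧ p K = x}

open MeasureTheory Filter Topology

/-- Affine self-maps `y ↦ A y + b` of `ℝ^n`, as pairs `(A, b)`. -/
abbrev AffMap (n : ℕ) : Type := (En n →L[ℝ] En n) × En n

namespace AffMap

variable {n : ℕ}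

/-- The value of an affine map at a point. -/
def eval (T : AffMap n) (y : En n) : En n := T.1 y + T.2

/-- The absolute value of the determinant of the linear part. -/
def absDet (T : AffMap n) : ℝ := |T.1.det|

/-- The affine maps sending `K` into `L`. -/
def mapsInto (K L : Set (En n)) : Set (AffMap n) := {T | ∀ y ∈ K, T.eval y ∈ L}

/-- Lebesgue measure on the space of affine maps. -/
abbrev haar (n : ℕ) : Measure (AffMap n) := Measure.addHaar

theorem continuous_eval (y : En n) : Continuous fun T : AffMap n => T.eval y := by
  unfold eval; fun_prop

theorem continuous_absDet : Continuous (absDet : AffMap n → ℝ) :=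
  (ContinuousLinearMap.continuous_det.comp continuous_fst).abs

theorem absDet_nonneg (T : AffMap n) : 0 ≤ T.absDet := abs_nonneg _

theorem convex_mapsInto (K : Set (En n)) {L : Set (En n)} (hL : Convex ℝ L) :
    Convex ℝ (mapsInto K L) := by
  intro S hS T hT a b ha hb hab y hy
  have h := hL (hS y hy) (hT y hy) ha hb hab
  convert h using 1
  simp only [eval, Prod.fst_add, Prod.snd_add, Prod.smul_fst, Prod.smul_snd,
    _root_.add_apply, _root_.smul_apply, smul_add]
  abel

theorem isClosed_mapsInto (K : Set (En n)) {L : Set (En n)} (hL : IsClosed L) :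
    IsClosed (mapsInto K L) := by
  have : mapsInto K L = ⋂ y ∈ K, (fun T : AffMap n => T.eval y) ⁻¹' L := by
    ext T; simp [mapsInto]
  rw [this]
  exact isClosed_biInter fun y _ => hL.preimage (continuous_eval y)

theorem isBounded_mapsInto {K L : Set (En n)} (hK : (interior K).Nonempty)
    (hL : Bornology.IsBounded L) : Bornology.IsBounded (mapsInto K L) := by
  obtain ⟨y₀, hy₀⟩ := hK
  obtain ⟨r, hr, hrK⟩ := Metric.nhds_basis_closedBall.mem_iff.1 (mem_interior_iff_mem_nhds.1 hy₀)
  obtain ⟨R, hR, hLR⟩ := hL.exists_pos_norm_le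
  have hA : ∀ T ∈ mapsInto K L, ‖T.1‖ ≤ 2 * R / r := by
    intro T hT
    refine ContinuousLinearMap.opNorm_le_of_unit_norm (by positivity) fun v hv => ?_
    have h1 := hLR _ (hT y₀ (hrK (mem_closedBall_self hr.le)))
    have h2 := hLR _ (hT (y₀ + r • v) (hrK (by simp [norm_smul, hv, abs_of_pos hr])))
    have h3 : r • T.1 v = T.eval (y₀ + r • v) - T.eval y₀ := by simp [eval]
    have h4 : r * ‖T.1 v‖ ≤ R + R := by
      rw [← abs_of_pos hr, ← Real.norm_eq_abs, ← norm_smul, h3]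
      exact (norm_sub_le _ _).trans (add_le_add h2 h1)
    rw [le_div_iff₀ hr]; linarith
  refine isBounded_iff_forall_norm_le.2 ⟨max (2 * R / r) (R + 2 * R / r * ‖y₀‖), fun T hT => ?_⟩
  refine max_le_max (hA T hT) ?_
  have h1 := hLR _ (hT y₀ (hrK (mem_closedBall_self hr.le)))
  have h2 : T.2 = T.eval y₀ - T.1 y₀ := by simp [eval]
  rw [h2]
  refine (norm_sub_le _ _).trans (add_le_add h1 ((T.1.le_opNorm _).trans ?_))
  gcongr
  exact hA T hT

theorem isCompact_mapsInto {K L : Set (En n)} (hK : (interior K).Nonempty)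
    (hL : IsCompact L) : IsCompact (mapsInto K L) :=
  Metric.isCompact_of_isClosed_isBounded (isClosed_mapsInto K hL.isClosed)
    (isBounded_mapsInto hK hL.isBounded)

theorem eval_mem_interior {K L : Set (En n)} {T : AffMap n} (hT : T ∈ interior (mapsInto K L))
    {y : En n} (hy : y ∈ K) : T.eval y ∈ interior L := by
  rw [mem_interior_iff_mem_nhds] at hT ⊢
  have hc : Continuous fun z : En n => ((T.1, z - T.1 y) : AffMap n) := by fun_prop
  have h := hc.continuousAt.preimage_mem_nhds (x := T.eval y) (t := mapsInto K L)
    (by simpa [eval] using hT)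
  filter_upwards [h] with z hz
  simpa [eval] using hz y hy

theorem exists_mem_interior_absDet_pos {K L : Set (En n)} (hK : Bornology.IsBounded K)
    (hL : (interior L).Nonempty) : ∃ T ∈ interior (mapsInto K L), 0 < T.absDet := by
  obtain ⟨z, hz⟩ := hL
  obtain ⟨r, hr, hrL⟩ := Metric.mem_nhds_iff.1 (mem_interior_iff_mem_nhds.1 hz)
  obtain ⟨R, hR, hKR⟩ := hK.exists_pos_norm_le
  have ht : 0 < r / (2 * R) := by positivity
  refine ⟨((r / (2 * R)) • ContinuousLinearMap.id ℝ (En n), z), ?_, ?_⟩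
  · have hopen : IsOpen {T : AffMap n | ‖T.1‖ * R + ‖T.2 - z‖ < r} :=
      isOpen_lt (by fun_prop) continuous_const
    refine interior_maximal ?_ hopen ?_
    · intro T hT y hy
      apply hrL
      rw [mem_ball_iff_norm]
      have : T.eval y - z = T.1 y + (T.2 - z) := by simp [eval, add_sub_assoc]
      rw [this]
      refine lt_of_le_of_lt ((norm_add_le _ _).trans (add_le_add_left ?_ _)) hT
      exact (T.1.le_opNorm y).trans (mul_le_mul_of_nonneg_left (hKR y hy) (norm_nonneg _))
    · have h1 : ‖(r / (2 * R)) • ContinuousLinearMap.id ℝ (En n)‖ ≤ r / (2 * R) := by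
        rw [norm_smul, Real.norm_of_nonneg ht.le]
        exact mul_le_of_le_one_right ht.le ContinuousLinearMap.norm_id_le
      have h2 : r / (2 * R) * R = r / 2 := by field_simp
      have h3 := mul_le_mul_of_nonneg_right h1 hR.le
      simp only [mem_ofPred_eq, sub_self, norm_zero, add_zero]
      linarith
  · have : (ContinuousLinearMap.det ((r / (2 * R)) • ContinuousLinearMap.id ℝ (En n))) =
        (r / (2 * R)) ^ n := by
      simp [ContinuousLinearMap.det, LinearMap.det_smul]
    simp only [absDet, this]
    positivity

theorem integrableOn_mapsInto {F : Type*} [NormedAddCommGroup F] {K L : Set (En n)}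
    (hK : (interior K).Nonempty) (hL : IsCompact L) {φ : AffMap n → F} (hφ : Continuous φ) :
    IntegrableOn φ (mapsInto K L) (haar n) :=
  hφ.continuousOn.integrableOn_compact (isCompact_mapsInto hK hL)

end AffMap

/-- A ball contained in a set that is Hausdorff-close to a closed convex set `L` has its centre
in `L`. -/
theorem mem_of_closedBall_subset_near {n : ℕ} {L : Set (En n)} (hne : L.Nonempty)
    (hcl : IsClosed L) (hconv : Convex ℝ L) {y : En n} {ε : ℝ} (hε : 0 < ε)
    (h : ∀ z ∈ closedBall y ε, ∃ w ∈ L, dist z w < ε) : y ∈ L := by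
  by_contra hy
  obtain ⟨v, hv, hmin⟩ := exists_norm_eq_iInf_of_complete_convex hne hcl.isComplete hconv y
  have hinner := (norm_eq_iInf_iff_real_inner_le_zero hconv hv).1 hmin
  have hpos : 0 < ‖y - v‖ := norm_pos_iff.2 (sub_ne_zero.2 fun e => hy (e ▸ hv))
  set u := y - v with hu
  obtain ⟨w, hw, hdist⟩ := h (y + (ε / ‖u‖) • u) (by
    simp [norm_smul, abs_of_pos hε, hpos.ne'])
  have h1 := hinner w hw
  have h2 : y + (ε / ‖u‖) • u - w = u + (ε / ‖u‖) • u - (w - v) := by rw [hu]; abel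
  have h3 : inner ℝ u (y + (ε / ‖u‖) • u - w) ≤ ‖u‖ * ‖y + (ε / ‖u‖) • u - w‖ :=
    real_inner_le_norm _ _
  rw [dist_eq_norm] at hdist
  have h4 : ‖u‖ * ‖y + (ε / ‖u‖) • u - w‖ < ‖u‖ * ε := by gcongr
  rw [h2, inner_sub_right, inner_add_right, inner_smul_right, real_inner_self_eq_norm_sq,
    ← h2] at h3
  have h5 : ε / ‖u‖ * ‖u‖ ^ 2 = ‖u‖ * ε := by field_simp
  nlinarith [sq_nonneg ‖u‖]

namespace KBody

open AffMap

variable {n : ℕ}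

theorem exists_dist_lt {L M : KBody n} {r : ℝ} (h : dist L M < r) {x : En n}
    (hx : x ∈ (L.1 : Set (En n))) : ∃ y ∈ (M.1 : Set (En n)), dist x y < r :=
  exists_dist_lt_of_hausdorffDist_lt hx
    (by rwa [ConvexBody.hausdorffDist_coe, ← Subtype.dist_eq]) ConvexBody.hausdorffEDist_ne_top

theorem eventually_mapsInto_subset {K : Set (En n)} (hK : IsCompact K) {L : KBody n}
    {T : AffMap n} (hT : ∀ y ∈ K, T.eval y ∈ interior (L.1 : Set (En n))) :
    ∀ᶠ M : KBody n in 𝓝 L, T ∈ mapsInto K (M.1 : Set (En n)) := by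
  have hcont : Continuous T.eval := by unfold eval; fun_prop
  obtain ⟨ε, hε, hsub⟩ := (hK.image hcont).exists_cthickening_subset_open isOpen_interior
    (image_subset_iff.2 hT)
  filter_upwards [Metric.ball_mem_nhds L hε] with M hM y hy
  refine mem_of_closedBall_subset_near M.1.nonempty M.1.isClosed M.1.convex hε fun z hz => ?_
  refine exists_dist_lt (L := L) (by rwa [dist_comm]) (interior_subset (hsub ?_))
  exact closedBall_subset_cthickening (mem_image_of_mem _ hy) ε hz

theorem eventually_notMem_mapsInto {K : Set (En n)} {L : KBody n} {T : AffMap n}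
    (hT : T ∉ mapsInto K (L.1 : Set (En n))) :
    ∀ᶠ M : KBody n in 𝓝 L, T ∉ mapsInto K (M.1 : Set (En n)) := by
  simp only [mapsInto, mem_ofPred_eq, not_forall] at hT ⊢
  obtain ⟨y, hy, hyL⟩ := hT
  obtain ⟨ε, hε, hsub⟩ := Metric.isOpen_iff.1 L.1.isClosed.isOpen_compl _ hyL
  filter_upwards [Metric.ball_mem_nhds L hε] with M hM
  refine ⟨y, hy, fun hyM => ?_⟩
  obtain ⟨z, hz, hd⟩ := exists_dist_lt (M := L) hM hyM
  exact hsub (by rwa [mem_ball, dist_comm]) hz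

theorem continuous_setIntegral_mapsInto {F : Type*} [NormedAddCommGroup F] [NormedSpace ℝ F]
    [SecondCountableTopology F] (K : KBody n) {φ : AffMap n → F} (hφ : Continuous φ) :
    Continuous fun L : KBody n => ∫ T in mapsInto (K.1 : Set (En n)) (L.1 : Set (En n)),
      φ T ∂(haar n) := by
  rw [continuous_iff_continuousAt]
  intro L
  obtain ⟨R, hR⟩ := L.1.isCompact.isBounded.subset_closedBall 0
  have hmeas : ∀ M : KBody n,
      MeasurableSet (mapsInto (K.1 : Set (En n)) (M.1 : Set (En n))) :=
    fun M => (isClosed_mapsInto _ M.1.isClosed).measurableSet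
  set B : Set (AffMap n) := mapsInto (K.1 : Set (En n)) (closedBall 0 (R + 1)) with hB
  have hBmeas : MeasurableSet B := (isClosed_mapsInto _ isClosed_closedBall).measurableSet
  have hind : (fun M : KBody n => ∫ T in mapsInto (K.1 : Set (En n)) (M.1 : Set (En n)),
      φ T ∂(haar n)) = fun M : KBody n =>
      ∫ T, (mapsInto (K.1 : Set (En n)) (M.1 : Set (En n))).indicator φ T ∂(haar n) :=
    funext fun M => (integral_indicator (hmeas M)).symm
  rw [hind]
  refine tendsto_integral_filter_of_dominated_convergence (B.indicator fun T => ‖φ T‖) ?_ ?_ ?_ ?_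
  · exact .of_forall fun M => hφ.aestronglyMeasurable.indicator (hmeas M)
  · filter_upwards [Metric.ball_mem_nhds L one_pos] with M hM
    refine .of_forall fun T => ?_
    rw [norm_indicator_eq_indicator_norm]
    refine indicator_le_indicator_of_subset (fun T hT y hy => ?_) (fun _ => norm_nonneg _) T
    obtain ⟨z, hz, hd⟩ := exists_dist_lt (M := L) hM (hT y hy)
    have := hR hz
    rw [mem_closedBall] at this ⊢
    linarith [dist_triangle (T.eval y) z 0]
  · rw [integrable_indicator_iff hBmeas]
    exact integrableOn_mapsInto K.2 (isCompact_closedBall _ _) hφ.norm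
  · have hnull : haar n (frontier (mapsInto (K.1 : Set (En n)) (L.1 : Set (En n)))) = 0 :=
      (convex_mapsInto _ L.1.convex).addHaar_frontier _
    filter_upwards [measure_eq_zero_iff_ae_notMem.1 hnull] with T hT
    refine tendsto_nhds_of_eventually_eq ?_
    by_cases hTL : T ∈ mapsInto (K.1 : Set (En n)) (L.1 : Set (En n))
    · rw [(isClosed_mapsInto _ L.1.isClosed).frontier_eq] at hT
      have hint : T ∈ interior (mapsInto (K.1 : Set (En n)) (L.1 : Set (En n))) := by
        by_contra h; exact hT ⟨hTL, h⟩
      filter_upwards [eventually_mapsInto_subset K.1.isCompact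
        fun y hy => eval_mem_interior hint hy] with M hM
      simp [hM, hTL]
    · filter_upwards [eventually_notMem_mapsInto hTL] with M hM
      simp [hM, hTL]

/-- The mass of `|det|^m` on the affine maps sending `K` into `L`. -/
def detMass (K : KBody n) (m : ℕ) (L : KBody n) : ℝ :=
  ∫ T in mapsInto (K.1 : Set (En n)) (L.1 : Set (En n)), T.absDet ^ m ∂(haar n)

/-- The integral of `|det T|^m T x` over the affine maps `T` sending `K` into `L`. -/
def detMoment (K : KBody n) (x : En n) (m : ℕ) (L : KBody n) : En n :=
  ∫ T in mapsInto (K.1 : Set (En n)) (L.1 : Set (En n)), T.absDet ^ m • T.eval x ∂(haar n)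

/-- The average of `T x` over the affine maps `T` sending `K` into `L`, weighted by `|det T|^m`. -/
def detMean (K : KBody n) (x : En n) (m : ℕ) (L : KBody n) : En n :=
  (detMass K m L)⁻¹ • detMoment K x m L

theorem detMass_pos (K : KBody n) (m : ℕ) (L : KBody n) : 0 < detMass K m L := by
  have hφ : Continuous fun T : AffMap n => T.absDet ^ m := continuous_absDet.pow m
  rw [detMass, setIntegral_pos_iff_support_of_nonneg_ae
    (.of_forall fun T => pow_nonneg T.absDet_nonneg m)
    (integrableOn_mapsInto K.2 L.1.isCompact hφ)]
  obtain ⟨T, hT, hpos⟩ := exists_mem_interior_absDet_pos K.1.isCompact.isBounded L.2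
  refine (IsOpen.measure_pos (haar n) ((isOpen_lt continuous_const continuous_absDet).inter
    isOpen_interior) ⟨T, hpos, hT⟩).trans_le (measure_mono ?_)
  rintro S ⟨hS, hS'⟩
  exact ⟨(pow_pos hS m).ne', interior_subset hS'⟩

theorem continuous_detMean (K : KBody n) (x : En n) (m : ℕ) : Continuous (detMean K x m) :=
  ((continuous_setIntegral_mapsInto K (continuous_absDet.pow m)).inv₀
    fun L => (detMass_pos K m L).ne').smul
    (continuous_setIntegral_mapsInto K ((continuous_absDet.pow m).smul (continuous_eval x)))

/-- Post-composition of affine maps by `g`. -/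
def postcomp (g : AffG n) (T : AffMap n) : AffMap n :=
  ((g.linear.toContinuousLinearEquiv : En n →L[ℝ] En n).comp T.1,
    g.linear.toContinuousLinearEquiv T.2) + (0, g 0)

theorem affG_apply (g : AffG n) (z : En n) : g z = g.linear z + g 0 := by
  simpa using g.map_vadd 0 z

theorem eval_postcomp (g : AffG n) (T : AffMap n) (y : En n) :
    (postcomp g T).eval y = g (T.eval y) := by
  rw [affG_apply g (T.eval y)]
  simp [postcomp, eval, add_assoc]

theorem absDet_postcomp (g : AffG n) (T : AffMap n) :
    (postcomp g T).absDet = |LinearMap.det (g.linear : En n →ₗ[ℝ] En n)| * T.absDet := by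
  rw [absDet, absDet, ← abs_mul, ContinuousLinearMap.det, ContinuousLinearMap.det,
    ← LinearMap.det_comp]
  congr 2
  ext1 v
  simp [postcomp]

theorem postcomp_mem_mapsInto_iff (g : AffG n) (K : Set (En n)) (L : KBody n) (T : AffMap n) :
    postcomp g T ∈ mapsInto K ((g • L : KBody n).1 : Set (En n)) ↔
      T ∈ mapsInto K (L.1 : Set (En n)) := by
  simp only [mapsInto, mem_ofPred_eq, eval_postcomp, smul_body_coe,
    g.injective.mem_set_image]

theorem exists_setIntegral_smul_eq (g : AffG n) (K : Set (En n)) :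
    ∃ c : ℝ, 0 < c ∧ ∀ (F : Type) [NormedAddCommGroup F] [NormedSpace ℝ F] (L : KBody n)
      (φ : AffMap n → F),
      ∫ T in mapsInto K ((g • L : KBody n).1 : Set (En n)), φ T ∂(haar n) =
        c • ∫ T in mapsInto K (L.1 : Set (En n)), φ (postcomp g T) ∂(haar n) := by
  set H := g.linear.toContinuousLinearEquiv with hH
  set Ψ : AffMap n ≃L[ℝ] AffMap n :=
    ((ContinuousLinearEquiv.refl ℝ (En n)).arrowCongr H).prodCongr H with hΨ
  have hdet : LinearMap.det (Ψ.toLinearEquiv : AffMap n →ₗ[ℝ] AffMap n) ≠ 0 :=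
    (LinearEquiv.isUnit_det' _).ne_zero
  have hpost : ∀ T, postcomp g T = Ψ T + (0, g 0) := fun T => rfl
  refine ⟨|LinearMap.det (Ψ.toLinearEquiv : AffMap n →ₗ[ℝ] AffMap n)|, abs_pos.2 hdet,
    fun F _ _ L φ => ?_⟩
  have hmeas : ∀ M : KBody n, MeasurableSet (mapsInto K (M.1 : Set (En n))) :=
    fun M => (isClosed_mapsInto _ M.1.isClosed).measurableSet
  have hmap := Measure.map_linearMap_addHaar_eq_smul_addHaar (haar n) hdet
  rw [← integral_indicator (hmeas _), ← integral_indicator (hmeas _),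
    ← integral_add_right_eq_self _ ((0, g 0) : AffMap n)]
  have h1 : ∀ f : AffMap n → F, ∫ T, f (Ψ T) ∂(haar n) =
      |LinearMap.det (Ψ.toLinearEquiv : AffMap n →ₗ[ℝ] AffMap n)|⁻¹ • ∫ T, f T ∂(haar n) := by
    intro f
    have h2 := Ψ.toHomeomorph.measurableEmbedding.integral_map (μ := haar n) f
    have h3 : Measure.map Ψ.toHomeomorph (haar n) = _ := hmap
    rw [h3, integral_smul_measure, ENNReal.toReal_ofReal (abs_nonneg _), abs_inv] at h2
    exact h2.symm
  have h4 := h1 fun T =>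
    (mapsInto K ((g • L : KBody n).1 : Set (En n))).indicator φ (T + (0, g 0))
  have h5 : (fun T => (mapsInto K (L.1 : Set (En n))).indicator
      (fun T => φ (postcomp g T)) T) = fun T =>
      (mapsInto K ((g • L : KBody n).1 : Set (En n))).indicator φ (Ψ T + (0, g 0)) := by
    funext T
    rw [← hpost]
    by_cases hT : T ∈ mapsInto K (L.1 : Set (En n))
    · simp [hT, (postcomp_mem_mapsInto_iff g K L T).2 hT]
    · simp [hT, mt (postcomp_mem_mapsInto_iff g K L T).1 hT]
  rw [h5, h4, smul_inv_smul₀ (abs_pos.2 hdet).ne']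

theorem detMean_smul (K : KBody n) (x : En n) (m : ℕ) (g : AffG n) (L : KBody n) :
    detMean K x m (g • L) = g (detMean K x m L) := by
  obtain ⟨c, hc, hint⟩ := exists_setIntegral_smul_eq g (K.1 : Set (En n))
  set d := |LinearMap.det (g.linear : En n →ₗ[ℝ] En n)| with hd
  have hdpos : 0 < d := abs_pos.2 (LinearEquiv.isUnit_det' _).ne_zero
  set H := (g.linear.toContinuousLinearEquiv : En n →L[ℝ] En n) with hH
  have hgH : ∀ z, g z = H z + g 0 := affG_apply g
  have hmass : detMass K m (g • L) = (c * d ^ m) * detMass K m L := by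
    rw [detMass, hint ℝ L]
    simp only [absDet_postcomp, mul_pow, integral_const_mul, smul_eq_mul, ← hd, mul_assoc]
    rfl
  have hi0 : IntegrableOn (fun T : AffMap n => T.absDet ^ m)
      (mapsInto (K.1 : Set (En n)) (L.1 : Set (En n))) (haar n) :=
    integrableOn_mapsInto K.2 L.1.isCompact (continuous_absDet.pow m)
  have hi1 : IntegrableOn (fun T : AffMap n => T.absDet ^ m • T.eval x)
      (mapsInto (K.1 : Set (En n)) (L.1 : Set (En n))) (haar n) :=
    integrableOn_mapsInto K.2 L.1.isCompact
      ((continuous_absDet.pow m).smul (continuous_eval x))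
  have hmoment : detMoment K x m (g • L) =
      (c * d ^ m) • (H (detMoment K x m L) + detMass K m L • g 0) := by
    have heq : ∀ T : AffMap n, (postcomp g T).absDet ^ m • (postcomp g T).eval x =
        d ^ m • (H (T.absDet ^ m • T.eval x) + T.absDet ^ m • g 0) := by
      intro T
      rw [absDet_postcomp, eval_postcomp, hgH (T.eval x), map_smul, ← smul_add, smul_smul,
        ← mul_pow]
    rw [detMoment, hint (En n) L]
    simp only [heq]
    rw [integral_smul, integral_add (H.integrable_comp hi1) (hi0.smul_const _),
      H.integral_comp_comm hi1, integral_smul_const, smul_smul]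
    rfl
  have hm := (detMass_pos K m L).ne'
  have hcd : c * d ^ m ≠ 0 := by positivity
  rw [detMean, hmass, hmoment, hgH (detMean K x m L), detMean, map_smul H, smul_smul, smul_add, smul_smul]
  have h1 : (c * d ^ m * detMass K m L)⁻¹ * (c * d ^ m) = (detMass K m L)⁻¹ := by field_simp
  rw [h1, inv_mul_cancel₀ hm, one_smul]

theorem isAffineInvariantPoint_detMean (K : KBody n) (x : En n) (m : ℕ) :
    IsAffineInvariantPoint (detMean K x m) :=
  ⟨continuous_detMean K x m, detMean_smul K x m⟩

theorem measure_pos (K : KBody n) : 0 < volume (K.1 : Set (En n)) :=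
  Measure.measure_pos_of_nonempty_interior _ K.2

theorem measure_image_eval (T : AffMap n) (K : Set (En n)) :
    volume (T.eval '' K) = ENNReal.ofReal T.absDet * volume K := by
  have : T.eval '' K = (fun z => z + T.2) '' (T.1 '' K) := by rw [image_image]; rfl
  rw [this, image_add_right, measure_preimage_add_right,
    Measure.addHaar_image_continuousLinearMap]
  rfl

theorem absDet_le_one {K : KBody n} {T : AffMap n}
    (hT : T ∈ mapsInto (K.1 : Set (En n)) (K.1 : Set (En n))) : T.absDet ≤ 1 := by
  have h : volume (T.eval '' (K.1 : Set (En n))) ≤ volume (K.1 : Set (En n)) :=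
    measure_mono (image_subset_iff.2 hT)
  rw [measure_image_eval] at h
  by_contra! hlt
  have h1 : (1 : ENNReal) < ENNReal.ofReal T.absDet := by simpa using hlt
  have h2 := ENNReal.mul_lt_mul_left (measure_pos K).ne' K.1.isCompact.measure_lt_top.ne h1
  rw [one_mul] at h2
  exact absurd h (not_le.2 h2)

theorem image_eval_eq {K : KBody n} {T : AffMap n}
    (hT : T ∈ mapsInto (K.1 : Set (En n)) (K.1 : Set (En n))) (hdet : T.absDet = 1) :
    T.eval '' (K.1 : Set (En n)) = (K.1 : Set (En n)) := by
  have hsub : T.eval '' (K.1 : Set (En n)) ⊆ (K.1 : Set (En n)) := image_subset_iff.2 hT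
  have hcont : Continuous T.eval := by unfold eval; fun_prop
  have hcomp := K.1.isCompact.image hcont
  have hvol : volume (T.eval '' (K.1 : Set (En n))) = volume (K.1 : Set (En n)) := by
    rw [measure_image_eval, hdet]; simp
  refine hsub.antisymm ?_
  have hdiff : volume ((K.1 : Set (En n)) \ T.eval '' (K.1 : Set (En n))) = 0 := by
    rw [measure_sdiff hsub hcomp.measurableSet.nullMeasurableSet hcomp.measure_lt_top.ne, hvol,
      tsub_self]
  have hint : interior (K.1 : Set (En n)) ⊆ T.eval '' (K.1 : Set (En n)) := by
    intro y hy
    by_contra hyT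
    have hopen := isOpen_interior.inter hcomp.isClosed.isOpen_compl (s := interior (K.1 : Set (En n)))
    refine (hopen.measure_pos volume ⟨y, hy, hyT⟩).ne' (measure_mono_null ?_ hdiff)
    exact fun z hz => ⟨interior_subset hz.1, hz.2⟩
  calc (K.1 : Set (En n)) = closure (interior (K.1 : Set (En n))) := by
        rw [K.1.convex.closure_interior_eq_closure_of_nonempty_interior K.2,
          K.1.isClosed.closure_eq]
    _ ⊆ _ := closure_minimal hint hcomp.isClosed

theorem eval_eq_of_absDet_eq_one {K : KBody n} {x : En n} (hx : x ∈ Fn K) {T : AffMap n}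
    (hT : T ∈ mapsInto (K.1 : Set (En n)) (K.1 : Set (En n))) (hdet : T.absDet = 1) :
    T.eval x = x := by
  have hne : LinearMap.det (T.1 : En n →ₗ[ℝ] En n) ≠ 0 := by
    intro h
    have : T.absDet = 0 := by rw [absDet, ContinuousLinearMap.det, h, abs_zero]
    linarith
  let g : AffG n := (LinearMap.equivOfDetNeZero _ hne).toAffineEquiv.trans
    (AffineEquiv.vaddConst ℝ T.2)
  have hg : ∀ y, g y = T.eval y := fun y => rfl
  rw [← hg]
  refine hx g (Subtype.ext (ConvexBody.ext ?_))
  rw [smul_body_coe]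
  exact image_eval_eq hT hdet

theorem exists_mem_mapsInto_absDet_eq_one (K : Set (En n)) :
    ∃ T ∈ mapsInto K K, T.absDet = 1 := by
  refine ⟨(ContinuousLinearMap.id ℝ (En n), 0), fun y hy => ?_, ?_⟩
  · simpa [eval] using hy
  · simp [absDet, ContinuousLinearMap.det]

theorem exists_mem_interior_lt_absDet (K : KBody n) {b : ℝ} (hb : b < 1) :
    ∃ T ∈ interior (mapsInto (K.1 : Set (En n)) (K.1 : Set (En n))), b < T.absDet := by
  obtain ⟨T₀, hT₀, -⟩ := exists_mem_interior_absDet_pos K.1.isCompact.isBounded K.2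
  obtain ⟨T₁, hT₁, hdet⟩ := exists_mem_mapsInto_absDet_eq_one (K.1 : Set (En n))
  have hmem : T₁ ∈ closure (interior (mapsInto (K.1 : Set (En n)) (K.1 : Set (En n)))) := by
    rw [Convex.closure_interior_eq_closure_of_nonempty_interior (𝕜 := ℝ)
      (by exact convex_mapsInto _ K.1.convex) ⟨_, hT₀⟩]
    exact subset_closure hT₁
  have hopen : IsOpen {T : AffMap n | b < T.absDet} := isOpen_lt continuous_const continuous_absDet
  obtain ⟨T, hT, hT'⟩ := mem_closure_iff.1 hmem _ hopen (hb.trans_eq hdet.symm)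
  exact ⟨T, hT', hT⟩

theorem tendsto_pow_div_detMass (K : KBody n) {a : ℝ} (ha : 0 ≤ a) (ha1 : a < 1) :
    Tendsto (fun m => a ^ m / detMass K m K) atTop (𝓝 0) := by
  obtain ⟨b, hab, hb⟩ := exists_between ha1
  have hb0 : 0 < b := ha.trans_lt hab
  obtain ⟨T₀, hT₀, hbT₀⟩ := exists_mem_interior_lt_absDet K hb
  set S := mapsInto (K.1 : Set (En n)) (K.1 : Set (En n)) with hS
  set U : Set (AffMap n) := {T | b < T.absDet} ∩ interior S with hU
  have hUopen : IsOpen U := (isOpen_lt continuous_const continuous_absDet).inter isOpen_interior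
  have hUS : U ⊆ S := inter_subset_right.trans interior_subset
  have hUfin : haar n U ≠ ⊤ :=
    ((measure_mono hUS).trans_lt (isCompact_mapsInto K.2 K.1.isCompact).measure_lt_top).ne
  have hUpos : 0 < (haar n).real U :=
    ENNReal.toReal_pos (hUopen.measure_pos _ ⟨T₀, hbT₀, hT₀⟩).ne' hUfin
  have hlow : ∀ m, b ^ m * (haar n).real U ≤ detMass K m K := by
    intro m
    have hi := integrableOn_mapsInto K.2 K.1.isCompact (continuous_absDet (n := n).pow m)
    calc b ^ m * (haar n).real U = ∫ _ in U, b ^ m ∂(haar n) := by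
          rw [setIntegral_const, smul_eq_mul, mul_comm]
      _ ≤ ∫ T in U, T.absDet ^ m ∂(haar n) := by
          refine setIntegral_mono_on (integrableOn_const hUfin) (hi.mono_set hUS)
            hUopen.measurableSet fun T hT => ?_
          exact pow_le_pow_left₀ hb0.le hT.1.le m
      _ ≤ _ := setIntegral_mono_set hi (.of_forall fun T => pow_nonneg T.absDet_nonneg m)
          hUS.eventuallyLE
  have hlim : Tendsto (fun m => (a / b) ^ m / (haar n).real U) atTop (𝓝 0) := by
    simpa using (tendsto_pow_atTop_nhds_zero_of_lt_one (by positivity)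
      ((div_lt_one hb0).2 hab)).div_const ((haar n).real U)
  refine squeeze_zero (fun m => div_nonneg (pow_nonneg ha m) (detMass_pos K m K).le)
    (fun m => ?_) hlim
  rw [div_pow, div_div]
  exact div_le_div_of_nonneg_left (pow_nonneg ha m) (by positivity) (hlow m)

theorem exists_absDet_le (K : KBody n) {x : En n} (hx : x ∈ Fn K) {ε : ℝ} (hε : 0 < ε) :
    ∃ a : ℝ, 0 ≤ a ∧ a < 1 ∧ ∀ T ∈ mapsInto (K.1 : Set (En n)) (K.1 : Set (En n)),
      ε ≤ ‖T.eval x - x‖ → T.absDet ≤ a := by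
  set S := mapsInto (K.1 : Set (En n)) (K.1 : Set (En n)) with hS
  have hcomp : IsCompact (S ∩ {T | ε ≤ ‖T.eval x - x‖}) :=
    (isCompact_mapsInto K.2 K.1.isCompact).inter_right
      (isClosed_le continuous_const ((continuous_eval x).sub continuous_const).norm)
  rcases (S ∩ {T | ε ≤ ‖T.eval x - x‖}).eq_empty_or_nonempty with hempty | hne
  · exact ⟨0, le_rfl, one_pos, fun T hT hT' => (eq_empty_iff_forall_notMem.1 hempty T ⟨hT, hT'⟩).elim⟩
  · obtain ⟨T₀, hT₀, hmax⟩ := hcomp.exists_isMaxOn hne continuous_absDet.continuousOn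
    refine ⟨T₀.absDet, T₀.absDet_nonneg, (absDet_le_one hT₀.1).lt_of_ne fun h => ?_,
      fun T hT hT' => hmax ⟨hT, hT'⟩⟩
    have h1 : ε ≤ ‖T₀.eval x - x‖ := hT₀.2
    rw [eval_eq_of_absDet_eq_one hx hT₀.1 h, sub_self, norm_zero] at h1
    exact absurd hε h1.not_gt

theorem norm_detMean_sub_le (K : KBody n) (x : En n) {ε a M : ℝ} (hε : 0 ≤ ε) (ha : 0 ≤ a)
    (hM : ∀ T ∈ mapsInto (K.1 : Set (En n)) (K.1 : Set (En n)), ‖T.eval x - x‖ ≤ M)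
    (hM0 : 0 ≤ M)
    (hdet : ∀ T ∈ mapsInto (K.1 : Set (En n)) (K.1 : Set (En n)),
      ε ≤ ‖T.eval x - x‖ → T.absDet ≤ a) (m : ℕ) :
    ‖detMean K x m K - x‖ ≤ ε + M * (haar n).real
      (mapsInto (K.1 : Set (En n)) (K.1 : Set (En n))) * (a ^ m / detMass K m K) := by
  set S := mapsInto (K.1 : Set (En n)) (K.1 : Set (En n)) with hS
  have hScomp : IsCompact S := isCompact_mapsInto K.2 K.1.isCompact
  have hD := detMass_pos K m K
  have hi0 : IntegrableOn (fun T : AffMap n => T.absDet ^ m) S (haar n) :=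
    integrableOn_mapsInto K.2 K.1.isCompact (continuous_absDet.pow m)
  have hi1 : IntegrableOn (fun T : AffMap n => T.absDet ^ m • T.eval x) S (haar n) :=
    integrableOn_mapsInto K.2 K.1.isCompact ((continuous_absDet.pow m).smul (continuous_eval x))
  have hsub : detMean K x m K - x = (detMass K m K)⁻¹ •
      ∫ T in S, T.absDet ^ m • (T.eval x - x) ∂(haar n) := by
    simp only [smul_sub]
    rw [integral_sub hi1 (hi0.smul_const x), integral_smul_const, smul_sub]
    change _ = _ - (detMass K m K)⁻¹ • detMass K m K • x
    rw [inv_smul_smul₀ hD.ne']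
    rfl
  have hconst : IntegrableOn (fun _ : AffMap n => M * a ^ m) S (haar n) :=
    integrableOn_const hScomp.measure_lt_top.ne
  have hbound : ‖∫ T in S, T.absDet ^ m • (T.eval x - x) ∂(haar n)‖ ≤
      ε * detMass K m K + M * a ^ m * (haar n).real S := by
    calc _ ≤ ∫ T in S, (ε * T.absDet ^ m + M * a ^ m) ∂(haar n) := by
          refine norm_integral_le_of_norm_le ((hi0.const_mul ε).add hconst) ?_
          refine (ae_restrict_iff' hScomp.measurableSet).2 (.of_forall fun T hT => ?_)
          have hp := pow_nonneg T.absDet_nonneg m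
          rw [norm_smul, Real.norm_of_nonneg hp]
          rcases le_total ε ‖T.eval x - x‖ with h | h
          · have h1 := pow_le_pow_left₀ T.absDet_nonneg (hdet T hT h) m
            have h2 := mul_le_mul h1 (hM T hT) (norm_nonneg _) (pow_nonneg ha m)
            nlinarith [mul_nonneg hε hp]
          · nlinarith [mul_le_mul_of_nonneg_left h hp, mul_nonneg hM0 (pow_nonneg ha m)]
      _ = _ := by
          rw [integral_add (hi0.const_mul ε) hconst, integral_const_mul, setIntegral_const,
            smul_eq_mul, mul_comm ((haar n).real S)]
          rfl
  rw [hsub, norm_smul, norm_inv, Real.norm_of_nonneg hD.le, inv_mul_le_iff₀ hD]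
  refine hbound.trans_eq ?_
  field_simp

theorem tendsto_detMean (K : KBody n) {x : En n} (hx : x ∈ Fn K) :
    Tendsto (fun m => detMean K x m K) atTop (𝓝 x) := by
  obtain ⟨M, hM⟩ := (isCompact_mapsInto K.2 K.1.isCompact).exists_bound_of_continuousOn
    ((continuous_eval x).sub (continuous_const (y := x))).continuousOn
  rw [Metric.tendsto_atTop']
  intro ε hε
  obtain ⟨a, ha, ha1, hdet⟩ := exists_absDet_le K hx (half_pos hε)
  have hlim := (tendsto_pow_div_detMass K ha ha1).const_mul (max M 0 * (haar n).real
    (mapsInto (K.1 : Set (En n)) (K.1 : Set (En n))))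
  rw [mul_zero] at hlim
  obtain ⟨N, hN⟩ := eventually_atTop.1 (hlim.eventually_lt_const (half_pos hε))
  refine ⟨N, fun m hm => ?_⟩
  rw [dist_eq_norm]
  have := norm_detMean_sub_le K x (half_pos hε).le ha
    (fun T hT => (hM T hT).trans (le_max_left M 0)) (le_max_right M 0) hdet m
  linarith [hN m hm.le]

/-- The values at `K` of affine invariant points form an affine subspace. -/
def invariantValues (K : KBody n) : AffineSubspace ℝ (En n) where
  carrier := Pn K
  smul_vsub_vadd_mem' := by
    rintro c _ _ _ ⟨p, hp, rfl⟩ ⟨q, hq, rfl⟩ ⟨r, hr, rfl⟩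
    refine ⟨fun L => c • (p L - q L) + r L,
      ⟨((hp.1.sub hq.1).const_smul c).add hr.1, fun g L => ?_⟩, rfl⟩
    simp only [hp.2, hq.2, hr.2]
    rw [affG_apply g (c • (p L - q L) + r L), affG_apply g (p L), affG_apply g (q L),
      affG_apply g (r L)]
    simp only [map_add, map_smul, map_sub, add_sub_add_right_eq_sub, add_assoc]

theorem Fn_subset_Pn (K : KBody n) : Fn K ⊆ Pn K := fun _ hx =>
  (invariantValues K).closed_of_finiteDimensional.mem_of_tendsto (tendsto_detMean K hx)
    (.of_forall fun m => ⟨_, isAffineInvariantPoint_detMean K _ m, rfl⟩)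

theorem Pn_subset_Fn (K : KBody n) : Pn K ⊆ Fn K := by
  rintro _ ⟨p, hp, rfl⟩ g hg
  rw [← hp.2, hg]

end KBody

/-- Grünbaum's conjecture: every point fixed by all affine symmetries of `K` is the
value at `K` of some affine invariant point; hence `P_n(K) = F_n(K)`. -/
theorem grunbaum_conjecture {n : ℕ} :
    (∀ (K : KBody n) (x : En n), x ∈ Fn K →
      ∃ p : KBody n → En n, IsAffineInvariantPoint p ∧ p K = x) ∧
    (∀ K : KBody n, Pn K = Fn K) := by
  exact ⟨fun K _ hx => KBody.Fn_subset_Pn K hx,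
    fun K => (KBody.Pn_subset_Fn K).antisymm (KBody.Fn_subset_Pn K)⟩

end
end

section
/- Proper version of Grünbaum's conjecture: if K is a convex body in ℝ^n and x ∈ Int(K) satisfies gx = x for every invertible affine map g with gK = K, then there exists a proper affine invariant point p (i.e., a continuous Aff(n)-equivariant map p : K_n → ℝ^n with p(A) ∈ Int(A) for all A) such that p(K) = x. -/
open Metric Set Pointwise

noncomputable section

open MeasureTheory Filter Topology

section Sandwich

variable {n : ℕ}

/-- Bodies close to `A₀` are squeezed between homothetic copies of `A₀`. -/
theorem KBody.eventually_homothety_mem (A₀ : KBody n) {a : En n}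
    (ha : a ∈ interior (A₀.1 : Set (En n))) {s : ℝ} (hs₀ : 0 < s) (hs₁ : s < 1) :
    ∀ᶠ A : KBody n in 𝓝 A₀, (∀ y ∈ A.1, a + s • (y - a) ∈ A₀.1) ∧
      ∀ y ∈ A₀.1, a + s • (y - a) ∈ A.1 := by
  obtain ⟨r, hr, hball⟩ := Metric.nhds_basis_closedBall.mem_iff.1 (mem_interior_iff_mem_nhds.1 ha)
  have hs : 0 < 1 - s := by linarith
  have hε : 0 < (1 - s) * r := by positivity
  filter_upwards [Metric.ball_mem_nhds A₀ hε] with A hA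
  have hd : hausdorffDist (A.1 : Set (En n)) (A₀.1 : Set (En n)) < (1 - s) * r := hA
  have hconv : ∀ z ∈ A₀.1, ∀ e : En n, ‖e‖ ≤ r → s • z + (1 - s) • (a + e) ∈ A₀.1 := by
    intro z hz e he
    refine A₀.1.convex hz (hball ?_) hs₀.le hs.le (by ring)
    simpa [mem_closedBall, dist_eq_norm] using he
  constructor
  · intro y hy
    obtain ⟨z, hz, hyz⟩ := Metric.exists_dist_lt_of_hausdorffDist_lt hy hd
      ConvexBody.hausdorffEDist_ne_top
    have key := hconv z hz ((s / (1 - s)) • (y - z)) (by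
      rw [norm_smul, Real.norm_of_nonneg (by positivity), div_mul_eq_mul_div, div_le_iff₀ hs]
      rw [dist_eq_norm] at hyz
      nlinarith [norm_nonneg (y - z)])
    convert key using 1
    rw [smul_add, smul_smul, mul_div_cancel₀ _ hs.ne']
    module
  · intro y hy
    by_contra hq
    set q := a + s • (y - a) with hq_def
    obtain ⟨z, hz, hzq⟩ := exists_norm_eq_iInf_of_complete_convex A.1.nonempty
      A.1.isCompact.isClosed.isComplete A.1.convex q
    have hproj := (norm_eq_iInf_iff_real_inner_le_zero A.1.convex hz).1 hzq
    have hqz : 0 < ‖q - z‖ := by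
      rw [norm_pos_iff, sub_ne_zero]
      rintro rfl
      exact hq hz
    set e : En n := ‖q - z‖⁻¹ • (q - z) with he
    have hnorm : ‖e‖ = 1 := by
      rw [he, norm_smul, norm_inv, norm_norm, inv_mul_cancel₀ hqz.ne']
    have hqe : q - z = ‖q - z‖ • e := by
      rw [he, smul_smul, mul_inv_cancel₀ hqz.ne', one_smul]
    have hmem := hconv y hy (r • e) (by rw [norm_smul, hnorm, Real.norm_of_nonneg hr.le, mul_one])
    obtain ⟨w, hw, hdist⟩ := Metric.exists_dist_lt_of_hausdorffDist_lt hmem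
      (by rwa [hausdorffDist_comm] at hd) ConvexBody.hausdorffEDist_ne_top
    have h1 : inner ℝ e (w - z) ≤ 0 := by
      rw [he, real_inner_smul_left]
      exact mul_nonpos_of_nonneg_of_nonpos (by positivity) (hproj w hw)
    have h2 : inner ℝ e (s • y + (1 - s) • (a + r • e) - w) < (1 - s) * r := by
      refine (real_inner_le_norm _ _).trans_lt ?_
      rw [hnorm, one_mul, ← dist_eq_norm]
      exact hdist
    have h3 : s • y + (1 - s) • (a + r • e) - w
        = (‖q - z‖ + (1 - s) * r) • e - (w - z) := by
      rw [add_smul, ← hqe, hq_def]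
      module
    rw [h3, inner_sub_right, real_inner_smul_right, real_inner_self_eq_norm_sq, hnorm] at h2
    nlinarith

end Sandwich

section AffineSelfMaps

variable {n : ℕ}

/-- Pairs `(M, v)`, standing for the affine self-maps `y ↦ M y + v`. -/
abbrev AMap (n : ℕ) : Type := (En n →L[ℝ] En n) × En n

/-- Evaluation of the affine map `y ↦ M y + v`. -/
def AMap.app (u : AMap n) (y : En n) : En n := u.1 y + u.2

theorem AMap.continuous_app (y : En n) : Continuous fun u : AMap n => u.app y := by
  unfold AMap.app
  fun_prop

theorem AMap.continuous_det : Continuous fun u : AMap n => u.1.det :=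
  ContinuousLinearMap.continuous_det.comp continuous_fst

theorem ContinuousLinearMap.differentiable_det :
    Differentiable ℝ fun M : En n →L[ℝ] En n => M.det := by
  have h : (fun M : En n →L[ℝ] En n => M.det) = fun M : En n →L[ℝ] En n =>
      ∑ σ : Equiv.Perm (Fin n), Equiv.Perm.sign σ •
        ∏ i, (M (EuclideanSpace.basisFun (Fin n) ℝ i)) (σ i) := by
    funext M
    rw [ContinuousLinearMap.det,
      ← LinearMap.det_toMatrix (EuclideanSpace.basisFun (Fin n) ℝ).toBasis, Matrix.det_apply]
    simp [LinearMap.toMatrix_apply]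
  rw [h]
  have h' : ∀ i j, Differentiable ℝ fun M : En n →L[ℝ] En n =>
      (M (EuclideanSpace.basisFun (Fin n) ℝ i)) j := fun i j =>
    ((EuclideanSpace.proj (𝕜 := ℝ) j).comp
      (ContinuousLinearMap.apply ℝ (En n) (EuclideanSpace.basisFun (Fin n) ℝ i))).differentiable
  refine Differentiable.fun_sum fun σ _ => ?_
  refine Differentiable.const_smul ?_ _
  exact fun M => (HasFDerivAt.finsetProd fun i _ => (h' i (σ i) M).hasFDerivAt).differentiableAt

/-- Composition of `u` with the homothety of centre `a` and ratio `s`. -/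
def AMap.shrink (a : En n) (s : ℝ) (u : AMap n) : AMap n := (s • u.1, a + s • (u.2 - a))

@[simp]
theorem AMap.app_shrink (a : En n) (s : ℝ) (u : AMap n) (y : En n) :
    (u.shrink a s).app y = a + s • (u.app y - a) := by
  simp only [AMap.app, AMap.shrink, smul_apply]
  module

theorem AMap.det_shrink (a : En n) (s : ℝ) (u : AMap n) :
    (u.shrink a s).1.det = s ^ n * u.1.det := by
  simp [AMap.shrink, ContinuousLinearMap.det, LinearMap.det_smul]

theorem AMap.shrink_shrink_inv (a : En n) {s : ℝ} (hs : s ≠ 0) (u : AMap n) :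
    (u.shrink a s⁻¹).shrink a s = u := by
  refine Prod.ext ?_ ?_ <;> simp [AMap.shrink, smul_smul, mul_inv_cancel₀ hs]

theorem AMap.shrink_inv_shrink (a : En n) {s : ℝ} (hs : s ≠ 0) (u : AMap n) :
    (u.shrink a s).shrink a s⁻¹ = u := by
  refine Prod.ext ?_ ?_ <;> simp [AMap.shrink, smul_smul, inv_mul_cancel₀ hs]

theorem AMap.continuous_shrink (a : En n) :
    Continuous fun q : ℝ × AMap n => q.2.shrink a q.1 := by
  unfold AMap.shrink
  fun_prop

theorem AMap.shrink_one (a : En n) (u : AMap n) : u.shrink a 1 = u := by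
  refine Prod.ext ?_ ?_ <;> simp [AMap.shrink]

theorem AMap.app_image (u : AMap n) (S : Set (En n)) :
    u.app '' S = (fun y => u.2 + y) '' (u.1 '' S) := by
  rw [Set.image_image]
  exact Set.image_congr fun y _ => add_comm _ _

theorem AMap.volume_app_image (u : AMap n) (S : Set (En n)) :
    volume.real (u.app '' S) = |u.1.det| * volume.real S := by
  rw [AMap.app_image, measureReal_def, Set.image_add_left, measure_preimage_add,
    Measure.addHaar_image_continuousLinearMap, ENNReal.toReal_mul,
    ENNReal.toReal_ofReal (abs_nonneg _), measureReal_def]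

/-- An affine map with nonzero determinant as an element of the affine group. -/
theorem AMap.exists_affineEquiv (u : AMap n) (hu : u.1.det ≠ 0) :
    ∃ g : AffG n, ∀ y, g y = u.app y := by
  refine ⟨(((u.1 : En n →ₗ[ℝ] En n).equivOfDetNeZero hu).toAffineEquiv.trans
    (AffineEquiv.constVAdd ℝ (En n) u.2)), fun y => ?_⟩
  simp [AMap.app, add_comm]

/-- The affine map underlying an element of the affine group. -/
def AMap.ofEquiv (g : AffG n) : AMap n :=
  (LinearMap.toContinuousLinearMap (g.linear : En n →ₗ[ℝ] En n), g 0)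

theorem AMap.app_ofEquiv (g : AffG n) (y : En n) : (AMap.ofEquiv g).app y = g y := by
  have := g.map_vadd 0 y
  simpa [AMap.app, AMap.ofEquiv] using this.symm

theorem AMap.det_ofEquiv_ne_zero (g : AffG n) : (AMap.ofEquiv g).1.det ≠ 0 :=
  (LinearEquiv.isUnit_det' g.linear).ne_zero

/-- Post-composition with an element of the affine group. -/
def AMap.postcomp (g : AffG n) (u : AMap n) : AMap n :=
  ((AMap.ofEquiv g).1.comp u.1, g u.2)

theorem AMap.app_postcomp (g : AffG n) (u : AMap n) (y : En n) :
    (AMap.postcomp g u).app y = g (u.app y) := by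
  rw [← AMap.app_ofEquiv, AMap.app, AMap.app, AMap.app, AMap.postcomp, ← AMap.app_ofEquiv g u.2]
  simp [AMap.app, add_assoc]

theorem AMap.det_postcomp (g : AffG n) (u : AMap n) :
    (AMap.postcomp g u).1.det = (AMap.ofEquiv g).1.det * u.1.det := by
  simp [AMap.postcomp, ContinuousLinearMap.det]

end AffineSelfMaps

section Inscribed

variable {n : ℕ}

/-- The affine maps sending `K` into `A`. -/
def inscribed (K A : KBody n) : Set (AMap n) := {u | ∀ y ∈ K.1, u.app y ∈ A.1}

theorem isClosed_inscribed (K A : KBody n) : IsClosed (inscribed K A) := by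
  simp only [inscribed, ofPred_forall]
  exact isClosed_biInter fun y _ => A.1.isCompact.isClosed.preimage (AMap.continuous_app y)

theorem convex_inscribed (K A : KBody n) : Convex ℝ (inscribed K A) := by
  intro u hu v hv s t hs ht hst y hy
  have h : (s • u + t • v).app y = s • u.app y + t • v.app y := by
    simp only [AMap.app, Prod.fst_add, Prod.snd_add, Prod.smul_fst, Prod.smul_snd,
      add_apply, smul_apply]
    module
  rw [h]
  exact A.1.convex (hu y hy) (hv y hy) hs ht hst

theorem isCompact_inscribed (K A : KBody n) : IsCompact (inscribed K A) := by
  refine Metric.isCompact_of_isClosed_isBounded (isClosed_inscribed K A) ?_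
  obtain ⟨k, hk⟩ := K.2
  obtain ⟨r, hr, hball⟩ := Metric.nhds_basis_closedBall.mem_iff.1 (mem_interior_iff_mem_nhds.1 hk)
  obtain ⟨R, hR⟩ := A.1.isCompact.isBounded.exists_norm_le
  have hkK : k ∈ K.1 := interior_subset hk
  have hfst : ∀ u ∈ inscribed K A, ‖u.1‖ ≤ 2 * R / r := by
    intro u hu
    have hR₀ : 0 ≤ R := (norm_nonneg _).trans (hR _ (hu k hkK))
    refine ContinuousLinearMap.opNorm_le_bound _ (by positivity) fun z => ?_
    rcases eq_or_ne z 0 with rfl | hz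
    · simp
    have hz' : 0 < ‖z‖ := norm_pos_iff.2 hz
    have hmem : k + (r / ‖z‖) • z ∈ K.1 := by
      refine hball ?_
      rw [mem_closedBall, dist_eq_norm, add_sub_cancel_left, norm_smul,
        Real.norm_of_nonneg (by positivity), div_mul_cancel₀ _ hz'.ne']
    have h1 : (r / ‖z‖) • u.1 z = u.app (k + (r / ‖z‖) • z) - u.app k := by
      simp [AMap.app]
    have h2 : (r / ‖z‖) * ‖u.1 z‖ ≤ R + R := by
      have := congrArg norm h1
      rw [norm_smul, Real.norm_of_nonneg (by positivity)] at this
      rw [this]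
      exact (norm_sub_le _ _).trans (add_le_add (hR _ (hu _ hmem)) (hR _ (hu _ hkK)))
    rw [div_mul_eq_mul_div, div_le_iff₀ hz'] at h2
    rw [div_mul_eq_mul_div, le_div_iff₀ hr]
    linarith
  refine isBounded_iff_forall_norm_le.2 ⟨max (2 * R / r) (R + 2 * R / r * ‖k‖), fun u hu => ?_⟩
  rw [Prod.norm_def]
  refine max_le_max (hfst u hu) ?_
  have h : u.2 = u.app k - u.1 k := by simp [AMap.app]
  rw [h]
  refine (norm_sub_le _ _).trans (add_le_add (hR _ (hu k hkK)) ?_)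
  exact (u.1.le_opNorm k).trans (by gcongr; exact hfst u hu)

theorem exists_mem_interior_inscribed (K A : KBody n) :
    ∃ u ∈ interior (inscribed K A), u.1.det ≠ 0 := by
  obtain ⟨a, ha⟩ := A.2
  obtain ⟨r, hr, hball⟩ := Metric.nhds_basis_closedBall.mem_iff.1 (mem_interior_iff_mem_nhds.1 ha)
  obtain ⟨R, hR₀, hR⟩ := K.1.isCompact.isBounded.exists_pos_norm_le
  refine ⟨((r / (2 * R)) • ContinuousLinearMap.id ℝ (En n), a), ?_, ?_⟩
  · rw [mem_interior_iff_mem_nhds, Metric.mem_nhds_iff]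
    refine ⟨r / (2 * (R + 1)), by positivity, fun u hu y hy => hball ?_⟩
    rw [mem_ball, dist_eq_norm, Prod.norm_def, max_lt_iff] at hu
    obtain ⟨h1, h2⟩ := hu
    simp only [Prod.fst_sub, Prod.snd_sub] at h1 h2
    have heq : u.app y - a = (u.1 - (r / (2 * R)) • ContinuousLinearMap.id ℝ (En n)) y
        + (r / (2 * R)) • y + (u.2 - a) := by
      simp only [AMap.app, sub_apply, smul_apply, ContinuousLinearMap.id_apply]
      module
    rw [mem_closedBall, dist_eq_norm, heq]
    have h3 : ‖(u.1 - (r / (2 * R)) • ContinuousLinearMap.id ℝ (En n)) y‖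
        ≤ r / (2 * (R + 1)) * R :=
      (ContinuousLinearMap.le_opNorm _ _).trans (mul_le_mul h1.le (hR y hy) (norm_nonneg _)
        (by positivity))
    have h4 : ‖(r / (2 * R)) • y‖ ≤ r / (2 * R) * R := by
      rw [norm_smul, Real.norm_of_nonneg (by positivity)]
      exact mul_le_mul_of_nonneg_left (hR y hy) (by positivity)
    have h5 : r / (2 * (R + 1)) * R + r / (2 * R) * R + r / (2 * (R + 1)) = r := by
      field_simp
      ring
    linarith [norm_add₃_le (a := (u.1 - (r / (2 * R)) • ContinuousLinearMap.id ℝ (En n)) y)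
      (b := (r / (2 * R)) • y) (c := u.2 - a)]
  · have : (0 : ℝ) < r / (2 * R) := by positivity
    simp [ContinuousLinearMap.det, LinearMap.det_smul, this.ne']

theorem AMap.app_mem_interior {K A : KBody n} {u : AMap n} (hu : u ∈ inscribed K A)
    (hdet : u.1.det ≠ 0) {x : En n} (hx : x ∈ interior (K.1 : Set (En n))) :
    u.app x ∈ interior (A.1 : Set (En n)) := by
  obtain ⟨g, hg⟩ := u.exists_affineEquiv hdet
  have hopen : IsOpen (g '' interior (K.1 : Set (En n))) := by
    rw [← g.coe_toHomeomorphOfFiniteDimensional]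
    exact (Homeomorph.isOpen_image _).2 isOpen_interior
  refine interior_maximal ?_ hopen ⟨x, hx, hg x⟩
  rintro _ ⟨y, hy, rfl⟩
  rw [hg]
  exact hu y (interior_subset hy)

theorem KBody.volume_pos (A : KBody n) : 0 < volume.real (A.1 : Set (En n)) :=
  ENNReal.toReal_pos (Measure.measure_pos_of_nonempty_interior _ A.2).ne'
    A.1.isCompact.measure_lt_top.ne

/-- The fraction of the volume of `A` filled by the image of `K` under `u`. -/
def fillRatio (K A : KBody n) (u : AMap n) : ℝ :=
  |u.1.det| * (volume.real (K.1 : Set (En n)) / volume.real (A.1 : Set (En n)))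

theorem continuous_fillRatio (K A : KBody n) : Continuous (fillRatio K A) :=
  AMap.continuous_det.abs.mul continuous_const

theorem fillRatio_nonneg (K A : KBody n) (u : AMap n) : 0 ≤ fillRatio K A u := by
  unfold fillRatio
  positivity

theorem fillRatio_eq (K A : KBody n) (u : AMap n) :
    fillRatio K A u = volume.real (u.app '' K.1) / volume.real (A.1 : Set (En n)) := by
  rw [fillRatio, AMap.volume_app_image, mul_div_assoc]

theorem fillRatio_ne_zero_iff {K A : KBody n} {u : AMap n} :
    fillRatio K A u ≠ 0 ↔ u.1.det ≠ 0 := by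
  simp [fillRatio, K.volume_pos.ne', A.volume_pos.ne']

theorem image_subset_of_mem_inscribed {K A : KBody n} {u : AMap n} (hu : u ∈ inscribed K A) :
    u.app '' K.1 ⊆ A.1 := by
  rintro _ ⟨y, hy, rfl⟩
  exact hu y hy

theorem fillRatio_le_one {K A : KBody n} {u : AMap n} (hu : u ∈ inscribed K A) :
    fillRatio K A u ≤ 1 := by
  rw [fillRatio_eq, div_le_one A.volume_pos]
  exact measureReal_mono (image_subset_of_mem_inscribed hu) A.1.isCompact.measure_lt_top.ne

theorem AMap.continuous_app_right (u : AMap n) : Continuous u.app := by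
  unfold AMap.app
  fun_prop

theorem image_eq_of_fillRatio_eq_one {K A : KBody n} {u : AMap n} (hu : u ∈ inscribed K A)
    (h : fillRatio K A u = 1) : u.app '' K.1 = A.1 := by
  refine (image_subset_of_mem_inscribed hu).antisymm ?_
  have hcomp : IsCompact (u.app '' K.1) := K.1.isCompact.image u.continuous_app_right
  have hsub : interior (A.1 : Set (En n)) ⊆ u.app '' K.1 := by
    rw [← sdiff_eq_empty]
    by_contra hne
    have hopen : IsOpen (interior (A.1 : Set (En n)) \ u.app '' K.1) :=
      isOpen_interior.sdiff hcomp.isClosed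
    have hpos := hopen.measure_pos volume (nonempty_iff_ne_empty.2 hne)
    rw [fillRatio_eq, div_eq_one_iff_eq A.volume_pos.ne'] at h
    have hzero : volume ((A.1 : Set (En n)) \ u.app '' K.1) = 0 := by
      rw [measure_sdiff (image_subset_of_mem_inscribed hu)
        hcomp.measurableSet.nullMeasurableSet hcomp.measure_lt_top.ne, tsub_eq_zero_iff_le]
      exact ((ENNReal.toReal_eq_toReal_iff' hcomp.measure_lt_top.ne
        A.1.isCompact.measure_lt_top.ne).1 h).ge
    exact hpos.ne' (measure_mono_null (sdiff_le_sdiff_right interior_subset) hzero)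
  have hcl := closure_minimal hsub hcomp.isClosed
  rwa [A.1.convex.closure_interior_eq_closure_of_nonempty_interior A.2,
    A.1.isCompact.isClosed.closure_eq] at hcl

theorem exists_smul_eq_of_fillRatio_eq_one {K A : KBody n} {u : AMap n}
    (hu : u ∈ inscribed K A) (h : fillRatio K A u = 1) :
    ∃ g : AffG n, g • K = A ∧ ∀ y, g y = u.app y := by
  obtain ⟨g, hg⟩ := u.exists_affineEquiv (fillRatio_ne_zero_iff.1 (h ▸ one_ne_zero))
  refine ⟨g, Subtype.ext (ConvexBody.ext ?_), hg⟩
  rw [smul_body_coe, ← image_eq_of_fillRatio_eq_one hu h]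
  exact image_congr fun y _ => hg y

theorem ofEquiv_mem_inscribed (g : AffG n) (K : KBody n) :
    AMap.ofEquiv g ∈ inscribed K (g • K) := by
  intro y hy
  rw [AMap.app_ofEquiv]
  exact mem_image_of_mem g hy

theorem volume_smul (g : AffG n) (A : KBody n) :
    volume.real ((g • A).1 : Set (En n))
      = |(AMap.ofEquiv g).1.det| * volume.real (A.1 : Set (En n)) := by
  rw [← AMap.volume_app_image, smul_body_coe]
  congr 1
  exact image_congr fun y _ => (AMap.app_ofEquiv g y).symm

theorem fillRatio_ofEquiv (g : AffG n) (K : KBody n) :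
    fillRatio K (g • K) (AMap.ofEquiv g) = 1 := by
  have h1 := K.volume_pos.ne'
  have h2 := abs_ne_zero.2 (AMap.det_ofEquiv_ne_zero g)
  rw [fillRatio, volume_smul]
  field_simp

theorem fillRatio_postcomp (g : AffG n) (K A : KBody n) (u : AMap n) :
    fillRatio K (g • A) (AMap.postcomp g u) = fillRatio K A u := by
  have h1 := A.volume_pos.ne'
  have h2 := abs_ne_zero.2 (AMap.det_ofEquiv_ne_zero g)
  rw [fillRatio, fillRatio, volume_smul, AMap.det_postcomp, abs_mul]
  field_simp

theorem postcomp_mem_inscribed_iff (g : AffG n) (K A : KBody n) (u : AMap n) :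
    AMap.postcomp g u ∈ inscribed K (g • A) ↔ u ∈ inscribed K A := by
  refine forall₂_congr fun y _ => ?_
  rw [AMap.app_postcomp]
  exact g.injective.mem_set_image

/-- Bodies close to `A₀` have nearly the same inscribed copies of `K` and nearly the same filling
ratios as `A₀`. -/
theorem eventually_shrink_inscribed (K A₀ : KBody n) {a : En n}
    (ha : a ∈ interior (A₀.1 : Set (En n))) {s : ℝ} (hs₀ : 0 < s) (hs₁ : s < 1) :
    ∀ᶠ A : KBody n in 𝓝 A₀,
      (∀ u ∈ inscribed K A₀, u.shrink a s ∈ inscribed K A) ∧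
      (∀ u ∈ inscribed K A, u.shrink a s ∈ inscribed K A₀) ∧
      s ^ n * volume.real (A.1 : Set (En n)) ≤ volume.real (A₀.1 : Set (En n)) ∧
      s ^ n * volume.real (A₀.1 : Set (En n)) ≤ volume.real (A.1 : Set (En n)) := by
  have hvol : ∀ A B : KBody n, (∀ y ∈ A.1, a + s • (y - a) ∈ B.1) →
      s ^ n * volume.real (A.1 : Set (En n)) ≤ volume.real (B.1 : Set (En n)) := by
    intro A B hAB
    have h := Measure.addHaar_image_homothety volume a s (A.1 : Set (En n))
    rw [finrank_euclideanSpace_fin] at h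
    have h' : volume.real (AffineMap.homothety a s '' (A.1 : Set (En n)))
        = s ^ n * volume.real (A.1 : Set (En n)) := by
      rw [measureReal_def, h, ENNReal.toReal_mul, ENNReal.toReal_ofReal (abs_nonneg _),
        abs_of_pos (by positivity), measureReal_def]
    rw [← h']
    refine measureReal_mono ?_ B.1.isCompact.measure_lt_top.ne
    rintro _ ⟨y, hy, rfl⟩
    simpa [AffineMap.homothety_apply, add_comm] using hAB y hy
  filter_upwards [A₀.eventually_homothety_mem ha hs₀ hs₁] with A hA
  refine ⟨fun u hu y hy => ?_, fun u hu y hy => ?_, hvol A A₀ hA.1, hvol A₀ A hA.2⟩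
  · rw [AMap.app_shrink]
    exact hA.2 _ (hu y hy)
  · rw [AMap.app_shrink]
    exact hA.1 _ (hu y hy)

theorem mul_fillRatio_le_fillRatio_shrink {K A A₀ : KBody n} {a : En n} {s : ℝ} (hs₀ : 0 < s)
    (h : s ^ n * volume.real (A₀.1 : Set (En n)) ≤ volume.real (A.1 : Set (En n)))
    (u : AMap n) :
    s ^ n * s ^ n * fillRatio K A u ≤ fillRatio K A₀ (u.shrink a s) := by
  have h0 := A₀.volume_pos
  have h1 := A.volume_pos
  rw [fillRatio, fillRatio, AMap.det_shrink, abs_mul, abs_of_pos (by positivity : 0 < s ^ n)]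
  have h2 : s ^ n / volume.real (A.1 : Set (En n)) ≤ 1 / volume.real (A₀.1 : Set (En n)) := by
    rw [div_le_div_iff₀ h1 h0]
    linarith
  calc _ = s ^ n * |u.1.det| * volume.real (K.1 : Set (En n)) *
        (s ^ n / volume.real (A.1 : Set (En n))) := by ring
    _ ≤ s ^ n * |u.1.det| * volume.real (K.1 : Set (En n)) *
        (1 / volume.real (A₀.1 : Set (En n))) := by gcongr
    _ = _ := by ring

theorem tendsto_volume (A₀ : KBody n) :
    Tendsto (fun A : KBody n => volume.real (A.1 : Set (En n))) (𝓝 A₀)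
      (𝓝 (volume.real (A₀.1 : Set (En n)))) := by
  obtain ⟨a, ha⟩ := A₀.2
  have h0 := A₀.volume_pos
  have hev : ∀ s ∈ Ioo (0 : ℝ) 1, ∀ᶠ A : KBody n in 𝓝 A₀,
      s ^ n * volume.real (A.1 : Set (En n)) ≤ volume.real (A₀.1 : Set (En n)) ∧
      s ^ n * volume.real (A₀.1 : Set (En n)) ≤ volume.real (A.1 : Set (En n)) := fun s hs =>
    (eventually_shrink_inscribed A₀ A₀ ha hs.1 hs.2).mono fun A hA => hA.2.2
  have hpow : Tendsto (fun s : ℝ => s ^ n) (𝓝[<] 1) (𝓝 1) := by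
    have : Tendsto (fun s : ℝ => s ^ n) (𝓝 1) (𝓝 (1 ^ n)) := (continuous_pow n).tendsto 1
    rw [one_pow] at this
    exact this.mono_left nhdsWithin_le_nhds
  have hIoo : ∀ᶠ s : ℝ in 𝓝[<] 1, s ∈ Ioo (0 : ℝ) 1 := Ioo_mem_nhdsLT one_pos
  refine tendsto_order.2 ⟨fun c hc => ?_, fun c hc => ?_⟩
  · have h1 : ∀ᶠ s : ℝ in 𝓝[<] 1, c < s ^ n * volume.real (A₀.1 : Set (En n)) := by
      refine (hpow.mul_const _).eventually (lt_mem_nhds ?_)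
      rwa [one_mul]
    obtain ⟨s, hs, hcs⟩ := (hIoo.and h1).exists
    filter_upwards [hev s hs] with A hA using hcs.trans_le hA.2
  · have h1 : ∀ᶠ s : ℝ in 𝓝[<] 1, volume.real (A₀.1 : Set (En n)) < s ^ n * c := by
      refine (hpow.mul_const _).eventually (lt_mem_nhds ?_)
      rwa [one_mul]
    obtain ⟨s, hs, hcs⟩ := (hIoo.and h1).exists
    filter_upwards [hev s hs] with A hA
    exact lt_of_mul_lt_mul_left (hA.1.trans_lt hcs) (pow_nonneg hs.1.le n)

end Inscribed

section WeightedIntegral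

variable {n : ℕ}

/-- The integral of `G` over all affine copies of `K` inside `A`, weighted by a function `φ` of the
filling ratio. -/
def copyIntegral {V : Type*} [NormedAddCommGroup V] [NormedSpace ℝ V] (K A : KBody n)
    (φ : ℝ → ℝ) (G : AMap n → V) : V :=
  ∫ u in inscribed K A, φ (fillRatio K A u) • G u ∂Measure.addHaar

theorem integrableOn_inscribed {W : Type*} [NormedAddCommGroup W] (K A : KBody n)
    {f : AMap n → W} (hf : Continuous f) :
    IntegrableOn f (inscribed K A) Measure.addHaar :=
  hf.continuousOn.integrableOn_compact (isCompact_inscribed K A)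

theorem setIntegral_inscribed_pos (K A : KBody n) {f : AMap n → ℝ} (hf : Continuous f)
    (hnonneg : ∀ u ∈ inscribed K A, 0 ≤ f u)
    (hpos : ∀ u ∈ inscribed K A, u.1.det ≠ 0 → 0 < f u) :
    0 < ∫ u in inscribed K A, f u ∂Measure.addHaar := by
  have hmeas := (isClosed_inscribed K A).measurableSet
  rw [setIntegral_pos_iff_support_of_nonneg_ae (ae_restrict_of_forall_mem hmeas hnonneg)
    (integrableOn_inscribed K A hf)]
  obtain ⟨u, hu, hdet⟩ := exists_mem_interior_inscribed K A
  have hopen : IsOpen (Function.support f ∩ interior (inscribed K A)) :=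
    (isOpen_ne_fun hf continuous_const).inter isOpen_interior
  exact (hopen.measure_pos _ ⟨u, (hpos u (interior_subset hu) hdet).ne', hu⟩).trans_le
    (measure_mono (inter_subset_inter_right _ interior_subset))

theorem isCompact_shrink_preimage (K A : KBody n) (a : En n) {s : ℝ} (hs : s ≠ 0) :
    IsCompact {u : AMap n | u.shrink a s ∈ inscribed K A} := by
  have hcont : Continuous fun u : AMap n => u.shrink a s⁻¹ :=
    (AMap.continuous_shrink a).comp (Continuous.prodMk_right s⁻¹)
  convert (isCompact_inscribed K A).image hcont using 1
  ext u
  constructor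
  · exact fun hu => ⟨_, hu, AMap.shrink_inv_shrink a hs u⟩
  · rintro ⟨v, hv, rfl⟩
    rw [mem_ofPred_eq, AMap.shrink_shrink_inv a hs]
    exact hv

theorem tendsto_shrink (a : En n) (u : AMap n) :
    Tendsto (fun s : ℝ => u.shrink a s) (𝓝[<] 1) (𝓝 u) := by
  have h : Continuous fun s : ℝ => u.shrink a s :=
    (AMap.continuous_shrink a).comp (Continuous.prodMk_left u)
  have := h.tendsto 1
  rw [AMap.shrink_one] at this
  exact this.mono_left nhdsWithin_le_nhds

theorem tendsto_shrink_inv (a : En n) (u : AMap n) :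
    Tendsto (fun s : ℝ => u.shrink a s⁻¹) (𝓝[<] 1) (𝓝 u) := by
  have h : ContinuousAt (fun s : ℝ => u.shrink a s⁻¹) 1 :=
    ((AMap.continuous_shrink a).comp (Continuous.prodMk_left u)).continuousAt.comp
      (f := fun s : ℝ => s⁻¹) (continuousAt_inv₀ one_ne_zero)
  have := h.tendsto
  rw [inv_one, AMap.shrink_one] at this
  exact this.mono_left nhdsWithin_le_nhds

theorem eventually_mem_inscribed (K : KBody n) {A₀ : KBody n} {u : AMap n}
    (hu : u ∈ interior (inscribed K A₀)) : ∀ᶠ A : KBody n in 𝓝 A₀, u ∈ inscribed K A := by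
  obtain ⟨a, ha⟩ := A₀.2
  have h := (tendsto_shrink_inv a u).eventually (mem_interior_iff_mem_nhds.1 hu)
  have hIoo : ∀ᶠ s : ℝ in 𝓝[<] 1, s ∈ Ioo (0 : ℝ) 1 := Ioo_mem_nhdsLT one_pos
  obtain ⟨s, hs, hmem⟩ := (hIoo.and h).exists
  filter_upwards [eventually_shrink_inscribed K A₀ ha hs.1 hs.2] with A hA
  have := hA.1 _ hmem
  rwa [AMap.shrink_shrink_inv a hs.1.ne'] at this

theorem eventually_notMem_inscribed (K : KBody n) {A₀ : KBody n} {u : AMap n}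
    (hu : u ∉ inscribed K A₀) : ∀ᶠ A : KBody n in 𝓝 A₀, u ∉ inscribed K A := by
  obtain ⟨a, ha⟩ := A₀.2
  have h := (tendsto_shrink a u).eventually ((isClosed_inscribed K A₀).isOpen_compl.mem_nhds hu)
  have hIoo : ∀ᶠ s : ℝ in 𝓝[<] 1, s ∈ Ioo (0 : ℝ) 1 := Ioo_mem_nhdsLT one_pos
  obtain ⟨s, hs, hmem⟩ := (hIoo.and h).exists
  filter_upwards [eventually_shrink_inscribed K A₀ ha hs.1 hs.2] with A hA hu'
  exact hmem (hA.2.1 _ hu')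

theorem tendsto_fillRatio (K A₀ : KBody n) (u : AMap n) :
    Tendsto (fun A : KBody n => fillRatio K A u) (𝓝 A₀) (𝓝 (fillRatio K A₀ u)) :=
  (tendsto_const_nhds.div (tendsto_volume A₀) A₀.volume_pos.ne').const_mul _

theorem continuous_copyIntegral {V : Type*} [NormedAddCommGroup V] [NormedSpace ℝ V]
    (K : KBody n) {φ : ℝ → ℝ} (hφ : Continuous φ) {G : AMap n → V} (hG : Continuous G) :
    Continuous fun A : KBody n => copyIntegral K A φ G := by
  refine continuous_iff_continuousAt.2 fun A₀ => ?_
  have hmeas : ∀ A, MeasurableSet (inscribed K A) := fun A => (isClosed_inscribed K A).measurableSet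
  have hcont : ∀ A, Continuous fun u => φ (fillRatio K A u) • G u := fun A =>
    (hφ.comp (continuous_fillRatio K A)).smul hG
  simp only [ContinuousAt, copyIntegral, ← integral_indicator (hmeas _)]
  obtain ⟨a, ha⟩ := A₀.2
  set D := {u : AMap n | u.shrink a 2⁻¹ ∈ inscribed K A₀}
  have hD : IsCompact D := isCompact_shrink_preimage K A₀ a (by norm_num)
  obtain ⟨B, hB⟩ := hD.exists_bound_of_continuousOn hG.continuousOn
  obtain ⟨b, hb⟩ := (isCompact_Icc (a := (0 : ℝ)) (b := 1)).exists_bound_of_continuousOn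
    hφ.continuousOn
  have hb₀ : 0 ≤ b := (norm_nonneg _).trans (hb 0 (by simp))
  refine tendsto_integral_filter_of_dominated_convergence (D.indicator fun _ => b * B) ?_ ?_ ?_ ?_
  · exact Eventually.of_forall fun A => (hcont A).aestronglyMeasurable.indicator (hmeas A)
  · filter_upwards [eventually_shrink_inscribed K A₀ ha (s := 2⁻¹) (by norm_num) (by norm_num)]
      with A hA
    refine Eventually.of_forall fun u => ?_
    by_cases hu : u ∈ inscribed K A
    · have huD : u ∈ D := hA.2.1 u hu
      rw [indicator_of_mem hu, indicator_of_mem huD, norm_smul]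
      exact mul_le_mul (hb _ ⟨fillRatio_nonneg K A u, fillRatio_le_one hu⟩) (hB u huD)
        (norm_nonneg _) hb₀
    · rw [indicator_of_notMem hu, norm_zero]
      exact indicator_nonneg
        (fun v hv => mul_nonneg hb₀ ((norm_nonneg _).trans (hB v hv))) u
  · exact (integrable_indicator_iff hD.measurableSet).2
      (integrableOn_const hD.measure_lt_top.ne)
  · have hfr := (convex_inscribed K A₀).addHaar_frontier Measure.addHaar
    filter_upwards [measure_eq_zero_iff_ae_notMem.1 hfr] with u hu
    by_cases hint : u ∈ interior (inscribed K A₀)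
    · rw [indicator_of_mem (interior_subset hint)]
      have h : Tendsto (fun A : KBody n => φ (fillRatio K A u) • G u) (𝓝 A₀)
          (𝓝 (φ (fillRatio K A₀ u) • G u)) :=
        ((hφ.tendsto _).comp (tendsto_fillRatio K A₀ u)).smul_const _
      refine h.congr' ?_
      filter_upwards [eventually_mem_inscribed K hint] with A hA
      rw [indicator_of_mem hA]
    · have hnot : u ∉ inscribed K A₀ := fun h => hu ⟨subset_closure h, hint⟩
      rw [indicator_of_notMem hnot]
      refine tendsto_const_nhds.congr' ?_
      filter_upwards [eventually_notMem_inscribed K hnot] with A hA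
      rw [indicator_of_notMem hA]

theorem AMap.ext_app {u v : AMap n} (h : ∀ y, u.app y = v.app y) : u = v := by
  have h0 : u.2 = v.2 := by simpa [AMap.app] using h 0
  refine Prod.ext (ContinuousLinearMap.ext fun y => ?_) h0
  have := h y
  rwa [AMap.app, AMap.app, h0, add_left_inj] at this

theorem AMap.continuous_postcomp (g : AffG n) : Continuous (AMap.postcomp g) := by
  have h : Continuous g := g.continuous_of_finiteDimensional
  unfold AMap.postcomp
  fun_prop

/-- Post-composition with an affine equivalence is a homeomorphism of the space of affine maps. -/
def AMap.postcompHomeomorph (g : AffG n) : AMap n ≃ₜ AMap n where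
  toFun := AMap.postcomp g
  invFun := AMap.postcomp g⁻¹
  left_inv u := AMap.ext_app fun y => by
    simp only [AMap.app_postcomp]
    exact g.symm_apply_apply _
  right_inv u := AMap.ext_app fun y => by
    simp only [AMap.app_postcomp]
    exact g.apply_symm_apply _
  continuous_toFun := AMap.continuous_postcomp g
  continuous_invFun := AMap.continuous_postcomp g⁻¹

theorem AMap.exists_map_postcomp_addHaar (g : AffG n) :
    ∃ c : ℝ, 0 < c ∧ Measure.map (AMap.postcomp g) (Measure.addHaar : Measure (AMap n))
      = ENNReal.ofReal c • Measure.addHaar := by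
  let L := (AMap.ofEquiv g).1
  let Λ : AMap n →L[ℝ] AMap n :=
    (ContinuousLinearMap.compL ℝ (En n) (En n) (En n) L).prodMap L
  have hΛ : AMap.postcomp g = (fun u : AMap n => u + ((0 : En n →L[ℝ] En n), g 0)) ∘ Λ := by
    funext u
    refine Prod.ext ?_ ?_
    · simp [AMap.postcomp, Λ, L]
    · simp only [AMap.postcomp, ← AMap.app_ofEquiv g u.2]
      rfl
  have hinj : Function.Injective (Λ : AMap n →ₗ[ℝ] AMap n) := by
    refine Function.Injective.of_comp (f := fun u : AMap n => u + ((0 : En n →L[ℝ] En n), g 0)) ?_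
    exact hΛ ▸ (AMap.postcompHomeomorph g).injective
  have hdet : LinearMap.det (Λ : AMap n →ₗ[ℝ] AMap n) ≠ 0 :=
    (LinearEquiv.isUnit_det' (LinearEquiv.ofInjectiveEndo _ hinj)).ne_zero
  refine ⟨|(LinearMap.det (Λ : AMap n →ₗ[ℝ] AMap n))⁻¹|, abs_pos.2 (inv_ne_zero hdet), ?_⟩
  rw [hΛ, ← Measure.map_map (by fun_prop) Λ.measurable]
  have h := Measure.map_linearMap_addHaar_eq_smul_addHaar
    (Measure.addHaar : Measure (AMap n)) hdet
  rw [ContinuousLinearMap.coe_coe] at h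
  rw [h, Measure.map_smul, map_add_right_eq_self]

theorem copyIntegral_smul (K : KBody n) (g : AffG n) :
    ∃ c : ℝ, 0 < c ∧ ∀ (A : KBody n) (φ : ℝ → ℝ),
      c * copyIntegral K (g • A) φ (fun _ => (1 : ℝ)) = copyIntegral K A φ (fun _ => (1 : ℝ)) ∧
      ∀ G : AMap n → En n, c • copyIntegral K (g • A) φ G
        = copyIntegral K A φ (fun u => G (AMap.postcomp g u)) := by
  obtain ⟨c, hc, hmap⟩ := AMap.exists_map_postcomp_addHaar g
  have key : ∀ (W : Type) [NormedAddCommGroup W] [NormedSpace ℝ W] (A : KBody n) (φ : ℝ → ℝ)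
      (G : AMap n → W), c • copyIntegral K (g • A) φ G
        = copyIntegral K A φ (fun u => G (AMap.postcomp g u)) := by
    intro W _ _ A φ G
    have hemb : MeasurableEmbedding (AMap.postcomp g) :=
      (AMap.postcompHomeomorph g).measurableEmbedding
    have h := hemb.setIntegral_map (μ := Measure.addHaar)
      (fun u => φ (fillRatio K (g • A) u) • G u) (inscribed K (g • A))
    have hpre : AMap.postcomp g ⁻¹' inscribed K (g • A) = inscribed K A := by
      ext u
      exact postcomp_mem_inscribed_iff g K A u
    rw [hmap, hpre, Measure.restrict_smul, integral_smul_measure,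
      ENNReal.toReal_ofReal hc.le] at h
    simpa only [copyIntegral, fillRatio_postcomp] using h
  exact ⟨c, hc, fun A φ => ⟨key ℝ A φ _, key (En n) A φ⟩⟩

end WeightedIntegral

section Concentration

variable {n : ℕ}

/-- A weight on filling ratios `t` whose singularity at `t = 1` is truncated at height `ε`. -/
def ratioWeight (n : ℕ) (ε t : ℝ) : ℝ :=
  t * (max (1 - t) ε)⁻¹ ^ (Module.finrank ℝ (AMap n) + 1)

theorem continuous_ratioWeight {ε : ℝ} (hε : 0 < ε) : Continuous (ratioWeight n ε) := by
  unfold ratioWeight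
  refine continuous_id.mul (Continuous.pow (Continuous.inv₀ (by fun_prop) fun t => ?_) _)
  exact (lt_max_of_lt_right hε).ne'

theorem ratioWeight_nonneg {ε t : ℝ} (hε : 0 ≤ ε) (ht : 0 ≤ t) : 0 ≤ ratioWeight n ε t := by
  have : 0 ≤ max (1 - t) ε := le_max_of_le_right hε
  unfold ratioWeight
  positivity

theorem ratioWeight_pos {ε t : ℝ} (hε : 0 < ε) (ht : 0 < t) : 0 < ratioWeight n ε t := by
  have : 0 < max (1 - t) ε := lt_max_of_lt_right hε
  unfold ratioWeight
  positivity

theorem ratioWeight_zero_eq {ε t : ℝ} (hε : 0 ≤ ε) (h : t ≤ 1 - ε) :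
    ratioWeight n 0 t = ratioWeight n ε t := by
  rw [ratioWeight, ratioWeight, max_eq_left (by linarith), max_eq_left (by linarith)]

theorem ratioWeight_le_ratioWeight_zero {ε t : ℝ} (h0 : 0 ≤ t) (h1 : t < 1) :
    ratioWeight n ε t ≤ ratioWeight n 0 t := by
  have h2 : 0 < 1 - t := by linarith
  rw [ratioWeight, ratioWeight, max_eq_left h2.le]
  have h3 : 0 < max (1 - t) ε := lt_max_of_lt_left h2
  gcongr
  exact le_max_left _ _

theorem ratioWeight_zero_le {δ t : ℝ} (hδ : 0 < δ) (h1 : t ≤ 1 - δ) :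
    ratioWeight n 0 t ≤ δ⁻¹ ^ (Module.finrank ℝ (AMap n) + 1) := by
  have h2 : δ ≤ 1 - t := by linarith
  rw [ratioWeight, max_eq_left (by linarith)]
  have h3 : (1 - t)⁻¹ ≤ δ⁻¹ := inv_anti₀ hδ h2
  have h4 : 0 ≤ (1 - t)⁻¹ := inv_nonneg.2 (by linarith)
  calc _ ≤ 1 * (1 - t)⁻¹ ^ (Module.finrank ℝ (AMap n) + 1) := by gcongr; linarith
    _ ≤ _ := by rw [one_mul]; gcongr

theorem exists_fillRatio_lipschitz (K A : KBody n) (u₀ : AMap n) :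
    ∃ L > 0, ∀ᶠ u in 𝓝 u₀, |fillRatio K A u - fillRatio K A u₀| ≤ L * ‖u - u₀‖ := by
  have hdiff : DifferentiableAt ℝ (fun u : AMap n => u.1.det) u₀ :=
    (ContinuousLinearMap.differentiable_det u₀.1).comp u₀ differentiableAt_fst
  obtain ⟨C, hC, hbound⟩ := hdiff.isBigO_sub.exists_pos
  have hκ : 0 < volume.real (K.1 : Set (En n)) / volume.real (A.1 : Set (En n)) :=
    div_pos K.volume_pos A.volume_pos
  refine ⟨C * (volume.real (K.1 : Set (En n)) / volume.real (A.1 : Set (En n))),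
    mul_pos hC hκ, ?_⟩
  filter_upwards [hbound.bound] with u hu
  rw [fillRatio, fillRatio, ← sub_mul, abs_mul, abs_of_pos hκ, mul_right_comm]
  gcongr
  exact (abs_abs_sub_abs_le_abs_sub _ _).trans hu

/-- Shrinking a ball in a convex set towards one of its points `w` produces sets near `w` whose
measure decays like a power of the ratio. -/
theorem Convex.exists_subset_measure_eq_pow {W : Type*} [NormedAddCommGroup W] [NormedSpace ℝ W]
    [FiniteDimensional ℝ W] [MeasurableSpace W] [BorelSpace W] (μ : Measure W)
    [μ.IsAddHaarMeasure] {C : Set W} (hC : Convex ℝ C) (hne : (interior C).Nonempty) {w : W}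
    (hw : w ∈ C) :
    ∃ m > 0, ∃ R > 0, ∀ s : ℝ, 0 < s → s ≤ 1 → ∃ S ⊆ C, MeasurableSet S ∧
      μ.real S = s ^ Module.finrank ℝ W * m ∧ ∀ u ∈ S, ‖u - w‖ ≤ s * R := by
  obtain ⟨v, hv⟩ := hne
  obtain ⟨r, hr, hball⟩ := Metric.nhds_basis_ball.mem_iff.1 (mem_interior_iff_mem_nhds.1 hv)
  refine ⟨μ.real (ball v r), ENNReal.toReal_pos (measure_ball_pos _ _ hr).ne'
    measure_ball_lt_top.ne, ‖v - w‖ + r, by positivity, fun s hs hs1 =>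
    ⟨AffineMap.homothety w s '' ball v r, ?_, ?_, ?_, ?_⟩⟩
  · rintro _ ⟨z, hz, rfl⟩
    rw [AffineMap.homothety_eq_lineMap]
    exact hC.lineMap_mem hw (hball hz) ⟨hs.le, hs1⟩
  · exact (AffineMap.homothety_isOpenMap w s hs.ne' _ isOpen_ball).measurableSet
  · rw [measureReal_def, Measure.addHaar_image_homothety, ENNReal.toReal_mul,
      ENNReal.toReal_ofReal (abs_nonneg _), abs_of_pos (by positivity), measureReal_def]
  · rintro _ ⟨z, hz, rfl⟩
    rw [AffineMap.homothety_apply, vsub_eq_sub, vadd_eq_add, add_sub_cancel_right, norm_smul,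
      Real.norm_of_nonneg hs.le]
    gcongr
    rw [mem_ball, dist_eq_norm] at hz
    calc ‖z - w‖ = ‖(v - w) + (z - v)‖ := by congr 1; abel
      _ ≤ ‖v - w‖ + ‖z - v‖ := norm_add_le _ _
      _ ≤ ‖v - w‖ + r := by gcongr

theorem mul_le_copyIntegral {K A : KBody n} {ε b : ℝ} (hε : 0 < ε) {S : Set (AMap n)}
    (hS : MeasurableSet S) (hSsub : S ⊆ inscribed K A)
    (hb : ∀ u ∈ S, b ≤ ratioWeight n ε (fillRatio K A u)) :
    b * (Measure.addHaar : Measure (AMap n)).real S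
      ≤ copyIntegral K A (ratioWeight n ε) fun _ => (1 : ℝ) := by
  simp only [copyIntegral, smul_eq_mul, mul_one]
  have hint : IntegrableOn (fun u => ratioWeight n ε (fillRatio K A u)) (inscribed K A)
      Measure.addHaar :=
    integrableOn_inscribed K A ((continuous_ratioWeight hε).comp (continuous_fillRatio K A))
  have hfin : (Measure.addHaar : Measure (AMap n)) S ≠ ⊤ :=
    ((measure_mono hSsub).trans_lt (isCompact_inscribed K A).measure_lt_top).ne
  refine (setIntegral_ge_of_const_le_real hS hfin hb (hint.mono_set hSsub)).trans ?_
  exact setIntegral_mono_set hint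
    (ae_restrict_of_forall_mem (isClosed_inscribed K A).measurableSet fun u _ =>
      ratioWeight_nonneg hε.le (fillRatio_nonneg K A u))
    (Eventually.of_forall hSsub)

/-- On the orbit of `K` the truncated total weights are unbounded. -/
theorem exists_le_copyIntegral_ratioWeight (K A : KBody n) {u₀ : AMap n}
    (hu₀ : u₀ ∈ inscribed K A) (hone : fillRatio K A u₀ = 1) (M : ℝ) :
    ∃ ε > 0, M ≤ copyIntegral K A (ratioWeight n ε) fun _ => (1 : ℝ) := by
  obtain ⟨v₀, hv₀, -⟩ := exists_mem_interior_inscribed K A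
  obtain ⟨m, hm, R, hR, hcone⟩ := (convex_inscribed K A).exists_subset_measure_eq_pow
    Measure.addHaar ⟨v₀, hv₀⟩ hu₀
  obtain ⟨C, hC, hlip⟩ := exists_fillRatio_lipschitz K A u₀
  obtain ⟨δ, hδ, hlip⟩ := Metric.eventually_nhds_iff.1 hlip
  set c := 2⁻¹ * (C * R)⁻¹ ^ (Module.finrank ℝ (AMap n) + 1) * m with hc
  have hc₀ : 0 < c := by positivity
  have hlower : ∀ s : ℝ, 0 < s → s ≤ 1 → s * R < δ → C * (s * R) ≤ 1 / 2 →
      c * s⁻¹ ≤ copyIntegral K A (ratioWeight n (C * (s * R))) fun _ => (1 : ℝ) := by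
    intro s hs hs1 hsδ hsC
    obtain ⟨S, hSsub, hSmeas, hSvol, hSdist⟩ := hcone s hs hs1
    have hε₀ : 0 < C * (s * R) := by positivity
    refine le_trans (le_of_eq ?_) (mul_le_copyIntegral hε₀ hSmeas hSsub
      (b := 2⁻¹ * (C * (s * R))⁻¹ ^ (Module.finrank ℝ (AMap n) + 1)) fun u hu => ?_)
    · rw [hSvol, hc]
      generalize Module.finrank ℝ (AMap n) = d
      rw [show C * (s * R) = C * R * s by ring, mul_inv (C * R) s, mul_pow, inv_pow s]
      generalize (C * R)⁻¹ ^ (d + 1) = q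
      field_simp
      ring
    · have h1 := hlip (y := u) (by rw [dist_eq_norm]; exact (hSdist u hu).trans_lt hsδ)
      have h2 : |fillRatio K A u - 1| ≤ C * (s * R) :=
        (hone ▸ h1).trans (mul_le_mul_of_nonneg_left (hSdist u hu) hC.le)
      have h3 := (abs_le.1 h2).1
      rw [ratioWeight, max_eq_right (by linarith)]
      exact mul_le_mul_of_nonneg_right (by linarith) (by positivity)
  have hzero : Tendsto (fun s : ℝ => s * R) (𝓝[>] 0) (𝓝 0) := by
    have : Tendsto (fun s : ℝ => s * R) (𝓝 0) (𝓝 (0 * R)) := tendsto_id.mul_const R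
    rw [zero_mul] at this
    exact this.mono_left nhdsWithin_le_nhds
  have hzero' : Tendsto (fun s : ℝ => C * (s * R)) (𝓝[>] 0) (𝓝 0) := by
    simpa using hzero.const_mul C
  have htop : Tendsto (fun s : ℝ => c * s⁻¹) (𝓝[>] 0) atTop :=
    tendsto_inv_nhdsGT_zero.const_mul_atTop hc₀
  have hIoc : ∀ᶠ s : ℝ in 𝓝[>] 0, s ∈ Ioc (0 : ℝ) 1 := Ioc_mem_nhdsGT one_pos
  obtain ⟨s, hs, h1, h2, h3⟩ := (hIoc.and ((hzero.eventually (gt_mem_nhds hδ)).and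
    ((hzero'.eventually (ge_mem_nhds (show (0 : ℝ) < 1 / 2 by norm_num))).and
      (htop.eventually (eventually_ge_atTop M))))).exists
  exact ⟨C * (s * R), mul_pos hC (mul_pos hs.1 hR), h3.trans (hlower s hs.1 hs.2 h1 h2)⟩

theorem exists_lt_one_forall_fillRatio_le (K A : KBody n) {T : Set (AMap n)} (hT : IsCompact T)
    (h : ∀ u ∈ T, fillRatio K A u < 1) :
    ∃ c ∈ Ioo (0 : ℝ) 1, ∀ u ∈ T, fillRatio K A u ≤ c := by
  rcases T.eq_empty_or_nonempty with rfl | hne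
  · exact ⟨2⁻¹, by norm_num, by simp⟩
  obtain ⟨v, hv, hmax⟩ := hT.exists_isMaxOn hne (continuous_fillRatio K A).continuousOn
  refine ⟨(fillRatio K A v + 1) / 2, ⟨?_, ?_⟩, fun u hu => (hmax hu).trans ?_⟩
  · linarith [fillRatio_nonneg K A v]
  · linarith [h v hv]
  · linarith [h v hv]

theorem eventually_lt_pow_mul_pow_mul {c c' : ℝ} (h : c < c') :
    ∀ᶠ s : ℝ in 𝓝[<] 1, c < s ^ n * s ^ n * c' := by
  have hcont : Continuous fun s : ℝ => s ^ n * s ^ n * c' := by fun_prop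
  refine (hcont.continuousAt.mono_left nhdsWithin_le_nhds).eventually (lt_mem_nhds ?_)
  simpa using h

theorem eventually_fillRatio_le_of_forall_lt_one (K A₀ : KBody n)
    (h : ∀ u ∈ inscribed K A₀, fillRatio K A₀ u < 1) :
    ∃ ε > 0, ∀ᶠ A : KBody n in 𝓝 A₀, ∀ u ∈ inscribed K A, fillRatio K A u ≤ 1 - ε := by
  obtain ⟨a, ha⟩ := A₀.2
  obtain ⟨c, hc, hle⟩ := exists_lt_one_forall_fillRatio_le K A₀ (isCompact_inscribed K A₀) h
  have hcc : c < (1 + c) / 2 := by linarith [hc.2]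
  have hIoo : ∀ᶠ s : ℝ in 𝓝[<] 1, s ∈ Ioo (0 : ℝ) 1 := Ioo_mem_nhdsLT one_pos
  obtain ⟨s, hs, hsc⟩ := (hIoo.and (eventually_lt_pow_mul_pow_mul (n := n) hcc)).exists
  refine ⟨(1 - c) / 2, by linarith [hc.2], ?_⟩
  filter_upwards [eventually_shrink_inscribed K A₀ ha hs.1 hs.2] with A hA u hu
  have h1 := (mul_fillRatio_le_fillRatio_shrink hs.1 hA.2.2.2 u).trans (hle _ (hA.2.1 u hu))
  have h2 : 0 < s ^ n * s ^ n := mul_pos (pow_pos hs.1 n) (pow_pos hs.1 n)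
  have h3 := le_of_mul_le_mul_left (h1.trans hsc.le) h2
  linarith

/-- Near the orbit of `K`, copies of `K` with filling ratio close to one place the marked point
close to its prescribed position. -/
theorem eventually_norm_app_sub_lt (K A₀ : KBody n) {x y : En n}
    (hy : ∀ u ∈ inscribed K A₀, fillRatio K A₀ u = 1 → u.app x = y)
    {ρ : ℝ} (hρ : 0 < ρ) (hx : x ∈ K.1) :
    ∃ δ > 0, ∀ᶠ A : KBody n in 𝓝 A₀, ∀ u ∈ inscribed K A, 1 - δ < fillRatio K A u →
      ‖u.app x - y‖ < ρ := by
  obtain ⟨a, ha⟩ := A₀.2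
  set T := inscribed K A₀ ∩ {u | ρ / 2 ≤ ‖u.app x - y‖} with hT
  have hTc : IsCompact T := (isCompact_inscribed K A₀).inter_right
    (isClosed_le continuous_const ((AMap.continuous_app x).sub continuous_const).norm)
  obtain ⟨c, hc, hle⟩ := exists_lt_one_forall_fillRatio_le K A₀ hTc (by
    intro u hu
    refine (fillRatio_le_one hu.1).lt_of_ne fun h => ?_
    have h2 : ρ / 2 ≤ ‖u.app x - y‖ := hu.2
    rw [hy u hu.1 h, sub_self, norm_zero] at h2
    linarith)
  have hcc : c < (1 + c) / 2 := by linarith [hc.2]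
  obtain ⟨R, hR⟩ := A₀.1.isCompact.isBounded.subset_closedBall a
  have hlim : Tendsto (fun s : ℝ => (s⁻¹ - 1) * R) (𝓝[<] 1) (𝓝 0) := by
    have : ContinuousAt (fun s : ℝ => (s⁻¹ - 1) * R) 1 :=
      ((continuousAt_inv₀ one_ne_zero).sub continuousAt_const).mul continuousAt_const
    have := this.tendsto
    simp only [inv_one, sub_self, zero_mul] at this
    exact this.mono_left nhdsWithin_le_nhds
  have hIoo : ∀ᶠ s : ℝ in 𝓝[<] 1, s ∈ Ioo (0 : ℝ) 1 := Ioo_mem_nhdsLT one_pos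
  obtain ⟨s, hs, hsc, hsR⟩ := (hIoo.and ((eventually_lt_pow_mul_pow_mul (n := n) hcc).and
    (hlim.eventually (gt_mem_nhds (half_pos hρ))))).exists
  refine ⟨(1 - c) / 2, by linarith [hc.2], ?_⟩
  filter_upwards [eventually_shrink_inscribed K A₀ ha hs.1 hs.2] with A hA u hu hfill
  have hmem := hA.2.1 u hu
  have h1 := mul_fillRatio_le_fillRatio_shrink (K := K) (a := a) hs.1 hA.2.2.2 u
  have h2 : 0 < s ^ n * s ^ n := mul_pos (pow_pos hs.1 n) (pow_pos hs.1 n)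
  have h3 : c < fillRatio K A₀ (u.shrink a s) := by
    refine hsc.trans_le (le_trans ?_ h1)
    gcongr
    linarith
  have h4 : ‖(u.shrink a s).app x - y‖ < ρ / 2 := by
    by_contra! h
    exact (hle _ ⟨hmem, h⟩).not_gt h3
  have h5 : ‖(u.shrink a s).app x - a‖ ≤ R := by
    simpa [dist_eq_norm] using hR (hmem x hx)
  have h6 : u.app x - y
      = ((u.shrink a s).app x - y) + (s⁻¹ - 1) • ((u.shrink a s).app x - a) := by
    rw [AMap.app_shrink, sub_smul, one_smul, add_sub_cancel_left, smul_smul,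
      inv_mul_cancel₀ hs.1.ne']
    module
  have h7 : 0 ≤ s⁻¹ - 1 := sub_nonneg.2 ((one_le_inv₀ hs.1).2 hs.2.le)
  rw [h6]
  refine (norm_add_le _ _).trans_lt ?_
  rw [norm_smul, Real.norm_of_nonneg h7]
  have h8 := mul_le_mul_of_nonneg_left h5 h7
  linarith

end Concentration

section FittedPoint

variable {n : ℕ}

open Classical in
/-- The image of the marked point `x` of `K` averaged over all affine copies of `K` inside `A`,
with a weight that becomes singular as the copy fills `A`. -/
def fittedPoint (K : KBody n) (x : En n) (A : KBody n) : En n :=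
  if h : ∃ g : AffG n, g • K = A then h.choose x
  else (copyIntegral K A (ratioWeight n 0) fun _ => (1 : ℝ))⁻¹ •
    copyIntegral K A (ratioWeight n 0) fun u => u.app x

theorem fittedPoint_smul_self {K : KBody n} {x : En n}
    (hfix : ∀ g : AffG n, g • K = K → g x = x) (g : AffG n) :
    fittedPoint K x (g • K) = g x := by
  have h : ∃ g' : AffG n, g' • K = g • K := ⟨g, rfl⟩
  rw [fittedPoint, dif_pos h]
  have hs := hfix (g⁻¹ * h.choose) (by rw [mul_smul, h.choose_spec, inv_smul_smul])
  rw [← congrArg g hs]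
  exact (g.apply_symm_apply _).symm

theorem fillRatio_lt_one {K A : KBody n} (hA : ¬∃ g : AffG n, g • K = A) {u : AMap n}
    (hu : u ∈ inscribed K A) : fillRatio K A u < 1 :=
  (fillRatio_le_one hu).lt_of_ne fun h =>
    hA ((exists_smul_eq_of_fillRatio_eq_one hu h).imp fun _ hg => hg.1)

theorem copyIntegral_congr {V : Type*} [NormedAddCommGroup V] [NormedSpace ℝ V] {K A : KBody n}
    {φ ψ : ℝ → ℝ} (h : ∀ u ∈ inscribed K A, φ (fillRatio K A u) = ψ (fillRatio K A u))
    (G : AMap n → V) : copyIntegral K A φ G = copyIntegral K A ψ G :=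
  setIntegral_congr_fun (isClosed_inscribed K A).measurableSet fun u hu => by
    simp only [h u hu]

theorem eventually_ratioWeight_zero_eq {K A₀ : KBody n} (hA : ¬∃ g : AffG n, g • K = A₀) :
    ∃ ε > 0, ∀ᶠ A : KBody n in 𝓝 A₀, ∀ u ∈ inscribed K A,
      ratioWeight n 0 (fillRatio K A u) = ratioWeight n ε (fillRatio K A u) := by
  obtain ⟨ε, hε, h⟩ := eventually_fillRatio_le_of_forall_lt_one K A₀ fun u => fillRatio_lt_one hA
  exact ⟨ε, hε, h.mono fun A hA u hu => ratioWeight_zero_eq hε.le (hA u hu)⟩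

theorem exists_ratioWeight_zero_eq {K A : KBody n} (hA : ¬∃ g : AffG n, g • K = A) :
    ∃ ε > 0, ∀ u ∈ inscribed K A,
      ratioWeight n 0 (fillRatio K A u) = ratioWeight n ε (fillRatio K A u) := by
  obtain ⟨ε, hε, h⟩ := eventually_ratioWeight_zero_eq hA
  exact ⟨ε, hε, h.self_of_nhds⟩

theorem continuous_ratioWeight_fillRatio (K A : KBody n) {ε : ℝ} (hε : 0 < ε) :
    Continuous fun u => ratioWeight n ε (fillRatio K A u) :=
  (continuous_ratioWeight hε).comp (continuous_fillRatio K A)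

theorem copyIntegral_ratioWeight_pos (K A : KBody n) {ε : ℝ} (hε : 0 < ε) :
    0 < copyIntegral K A (ratioWeight n ε) fun _ => (1 : ℝ) := by
  simp only [copyIntegral, smul_eq_mul, mul_one]
  exact setIntegral_inscribed_pos K A (continuous_ratioWeight_fillRatio K A hε)
    (fun u _ => ratioWeight_nonneg hε.le (fillRatio_nonneg K A u))
    fun u _ hdet => ratioWeight_pos hε
      ((fillRatio_nonneg K A u).lt_of_ne' (fillRatio_ne_zero_iff.2 hdet))

theorem integrableOn_ratioWeight_smul {V : Type*} [NormedAddCommGroup V] [NormedSpace ℝ V]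
    (K A : KBody n) {ε : ℝ} (hε : 0 < ε) {G : AMap n → V} (hG : Continuous G) :
    IntegrableOn (fun u => ratioWeight n ε (fillRatio K A u) • G u) (inscribed K A)
      Measure.addHaar :=
  integrableOn_inscribed K A ((continuous_ratioWeight_fillRatio K A hε).smul hG)

theorem exists_smul_eq_smul_iff (K A : KBody n) (g : AffG n) :
    (∃ h : AffG n, h • K = g • A) ↔ ∃ h : AffG n, h • K = A := by
  constructor
  · rintro ⟨h, hh⟩
    exact ⟨g⁻¹ * h, by rw [mul_smul, hh, inv_smul_smul]⟩
  · rintro ⟨h, rfl⟩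
    exact ⟨g * h, mul_smul _ _ _⟩

theorem fittedPoint_smul {K : KBody n} {x : En n} (hfix : ∀ g : AffG n, g • K = K → g x = x)
    (g : AffG n) (A : KBody n) : fittedPoint K x (g • A) = g (fittedPoint K x A) := by
  by_cases hA : ∃ h : AffG n, h • K = A
  · obtain ⟨h, rfl⟩ := hA
    rw [smul_smul, fittedPoint_smul_self hfix, fittedPoint_smul_self hfix]
    rfl
  have hgA := mt (exists_smul_eq_smul_iff K A g).1 hA
  rw [fittedPoint, fittedPoint, dif_neg hA, dif_neg hgA]
  obtain ⟨ε, hε, hw⟩ := exists_ratioWeight_zero_eq hA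
  obtain ⟨c, hc, hcI⟩ := copyIntegral_smul K g
  obtain ⟨h1, h2⟩ := hcI A (ratioWeight n 0)
  have h3 := h2 fun u => u.app x
  set I := copyIntegral K A (ratioWeight n 0) fun _ => (1 : ℝ) with hI
  have hIpos : 0 < I := by
    rw [hI, copyIntegral_congr hw]
    exact copyIntegral_ratioWeight_pos K A hε
  set J := copyIntegral K A (ratioWeight n 0) fun u => u.app x with hJ
  have h4 : copyIntegral K A (ratioWeight n 0) (fun u => (AMap.postcomp g u).app x)
      = (AMap.ofEquiv g).1 J + I • g 0 := by
    have hIint := integrableOn_ratioWeight_smul K A hε (continuous_const (y := (1 : ℝ)))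
    rw [hI, hJ, copyIntegral_congr hw, copyIntegral_congr hw, copyIntegral_congr hw]
    simp only [copyIntegral]
    rw [← integral_smul_const, ← ContinuousLinearMap.integral_comp_comm _
      (integrableOn_ratioWeight_smul K A hε (AMap.continuous_app x)),
      ← integral_add]
    · refine integral_congr_ae (Eventually.of_forall fun u => ?_)
      simp only [AMap.app_postcomp, ← AMap.app_ofEquiv g (u.app x), map_smul, smul_eq_mul, mul_one]
      rw [← smul_add]
      rfl
    · exact ((AMap.ofEquiv g).1.integrable_comp
        (integrableOn_ratioWeight_smul K A hε (AMap.continuous_app x)))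
    · exact hIint.smul_const _
  have h5 : copyIntegral K (g • A) (ratioWeight n 0) (fun _ => (1 : ℝ)) = c⁻¹ * I := by
    rw [← h1, inv_mul_cancel_left₀ hc.ne']
  have h6 : copyIntegral K (g • A) (ratioWeight n 0) (fun u => u.app x)
      = c⁻¹ • ((AMap.ofEquiv g).1 J + I • g 0) := by
    rw [← h4, ← h3, inv_smul_smul₀ hc.ne']
  rw [h5, h6, ← AMap.app_ofEquiv g (I⁻¹ • J), AMap.app, smul_smul, mul_inv, inv_inv,
    mul_right_comm, mul_inv_cancel₀ hc.ne', one_mul, smul_add, inv_smul_smul₀ hIpos.ne', map_smul]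
  rfl

theorem fittedPoint_mem_interior {K : KBody n} {x : En n}
    (hx : x ∈ interior (K.1 : Set (En n))) (hfix : ∀ g : AffG n, g • K = K → g x = x)
    (A : KBody n) : fittedPoint K x A ∈ interior (A.1 : Set (En n)) := by
  by_cases hA : ∃ h : AffG n, h • K = A
  · obtain ⟨g, rfl⟩ := hA
    rw [fittedPoint_smul_self hfix, ← AMap.app_ofEquiv]
    exact AMap.app_mem_interior (ofEquiv_mem_inscribed g K) (AMap.det_ofEquiv_ne_zero g) hx
  rw [fittedPoint, dif_neg hA]
  obtain ⟨ε, hε, hw⟩ := exists_ratioWeight_zero_eq hA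
  rw [copyIntegral_congr hw, copyIntegral_congr hw]
  have hIpos := copyIntegral_ratioWeight_pos K A hε
  set I := copyIntegral K A (ratioWeight n ε) fun _ => (1 : ℝ) with hI
  set J := copyIntegral K A (ratioWeight n ε) fun u => u.app x with hJ
  by_contra hnot
  obtain ⟨f, hf⟩ := geometric_hahn_banach_open_point A.1.convex.interior isOpen_interior hnot
  have hle : ∀ y ∈ A.1, f y ≤ f (I⁻¹ • J) := by
    have hcl : (A.1 : Set (En n)) ⊆ {y | f y ≤ f (I⁻¹ • J)} := by
      rw [← A.1.isCompact.isClosed.closure_eq,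
        ← A.1.convex.closure_interior_eq_closure_of_nonempty_interior A.2]
      exact closure_minimal (fun y hy => (hf y hy).le)
        (isClosed_le f.continuous continuous_const)
    exact fun y hy => hcl hy
  have hxK : x ∈ K.1 := interior_subset hx
  have hpos := setIntegral_inscribed_pos K A
    (f := fun u => ratioWeight n ε (fillRatio K A u) • (f (I⁻¹ • J) - f (u.app x)))
    ((continuous_ratioWeight_fillRatio K A hε).smul
      (continuous_const.sub (f.continuous.comp (AMap.continuous_app x))))
    (fun u hu => mul_nonneg (ratioWeight_nonneg hε.le (fillRatio_nonneg K A u))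
      (sub_nonneg.2 (hle _ (hu x hxK))))
    fun u hu hdet => mul_pos (ratioWeight_pos hε
      ((fillRatio_nonneg K A u).lt_of_ne' (fillRatio_ne_zero_iff.2 hdet)))
      (sub_pos.2 (hf _ (AMap.app_mem_interior hu hdet hx)))
  have hJint := integrableOn_ratioWeight_smul K A hε (AMap.continuous_app x)
  have hIint := integrableOn_ratioWeight_smul K A hε (continuous_const (y := (1 : ℝ)))
  have hzero : ∫ u in inscribed K A, ratioWeight n ε (fillRatio K A u) •
      (f (I⁻¹ • J) - f (u.app x)) ∂Measure.addHaar = I * f (I⁻¹ • J) - f J := by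
    have hfJ : f J = ∫ u in inscribed K A, f (ratioWeight n ε (fillRatio K A u) • u.app x)
        ∂Measure.addHaar := (f.integral_comp_comm hJint).symm
    rw [hfJ]
    generalize f (I⁻¹ • J) = t
    rw [hI, copyIntegral, ← integral_mul_const,
      ← integral_sub (hIint.mul_const _) (f.integrable_comp hJint)]
    refine integral_congr_ae (Eventually.of_forall fun u => ?_)
    simp only [smul_eq_mul, map_smul, mul_one, mul_sub]
  rw [hzero, map_smul, smul_eq_mul, mul_inv_cancel_left₀ hIpos.ne', sub_self] at hpos
  exact hpos.false

theorem continuousAt_fittedPoint_of_notMem_orbit {K : KBody n} (x : En n) {A₀ : KBody n}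
    (hA₀ : ¬∃ g : AffG n, g • K = A₀) : ContinuousAt (fittedPoint K x) A₀ := by
  obtain ⟨ε, hε, hw⟩ := eventually_ratioWeight_zero_eq hA₀
  obtain ⟨δ, hδ, hlt⟩ :=
    eventually_fillRatio_le_of_forall_lt_one K A₀ fun u => fillRatio_lt_one hA₀
  have hcont : ContinuousAt (fun A : KBody n =>
      (copyIntegral K A (ratioWeight n ε) fun _ => (1 : ℝ))⁻¹ •
        copyIntegral K A (ratioWeight n ε) fun u => u.app x) A₀ :=
    ((continuous_copyIntegral K (continuous_ratioWeight hε) continuous_const).continuousAt.inv₀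
      (copyIntegral_ratioWeight_pos K A₀ hε).ne').smul
      (continuous_copyIntegral K (continuous_ratioWeight hε)
        (AMap.continuous_app x)).continuousAt
  refine hcont.congr ?_
  filter_upwards [hw, hlt] with A hA hltA
  have hnot : ¬∃ g : AffG n, g • K = A := by
    rintro ⟨g, rfl⟩
    have := hltA _ (ofEquiv_mem_inscribed g K)
    rw [fillRatio_ofEquiv] at this
    linarith
  rw [fittedPoint, dif_neg hnot, copyIntegral_congr hA, copyIntegral_congr hA]

/-- A weighted average of points is close to `y` if the points far from `y` carry little weight. -/
theorem norm_average_sub_le {K A : KBody n} (x y : En n) {ε δ ρ R B : ℝ} (hε : 0 < ε)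
    (hρ : 0 ≤ ρ) (hR : 0 ≤ R) (hB : 0 ≤ B)
    (hnear : ∀ u ∈ inscribed K A, 1 - δ < fillRatio K A u → ‖u.app x - y‖ ≤ ρ)
    (hfar : ∀ u ∈ inscribed K A, ‖u.app x - y‖ ≤ R)
    (hweight : ∀ u ∈ inscribed K A, fillRatio K A u ≤ 1 - δ →
      ratioWeight n ε (fillRatio K A u) ≤ B) :
    (copyIntegral K A (ratioWeight n ε) fun _ => (1 : ℝ)) *
      ‖(copyIntegral K A (ratioWeight n ε) fun _ => (1 : ℝ))⁻¹ •
        (copyIntegral K A (ratioWeight n ε) fun u => u.app x) - y‖ ≤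
      ρ * (copyIntegral K A (ratioWeight n ε) fun _ => (1 : ℝ)) +
        B * R * (Measure.addHaar : Measure (AMap n)).real (inscribed K A) := by
  have hIpos := copyIntegral_ratioWeight_pos K A hε
  have hJint := integrableOn_ratioWeight_smul K A hε (AMap.continuous_app x)
  have hIint := integrableOn_ratioWeight_smul K A hε (continuous_const (y := (1 : ℝ)))
  have hdiff : copyIntegral K A (ratioWeight n ε) (fun u => u.app x - y)
      = copyIntegral K A (ratioWeight n ε) (fun u => u.app x) -
        (copyIntegral K A (ratioWeight n ε) fun _ => (1 : ℝ)) • y := by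
    simp only [copyIntegral]
    rw [← integral_smul_const, ← integral_sub hJint (hIint.smul_const _)]
    simp only [smul_sub, smul_eq_mul, mul_one]
  have hbound : ‖copyIntegral K A (ratioWeight n ε) (fun u => u.app x - y)‖ ≤
      ρ * (copyIntegral K A (ratioWeight n ε) fun _ => (1 : ℝ)) +
        B * R * (Measure.addHaar : Measure (AMap n)).real (inscribed K A) := by
    have hfin : (Measure.addHaar : Measure (AMap n)) (inscribed K A) ≠ ⊤ :=
      (isCompact_inscribed K A).measure_lt_top.ne
    have hcst : IntegrableOn (fun _ : AMap n => B * R) (inscribed K A) Measure.addHaar :=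
      integrableOn_const hfin
    have hrhs : ∫ u in inscribed K A, (ρ * (ratioWeight n ε (fillRatio K A u) • (1 : ℝ)) + B * R)
        ∂Measure.addHaar = ρ * (copyIntegral K A (ratioWeight n ε) fun _ => (1 : ℝ)) +
        B * R * (Measure.addHaar : Measure (AMap n)).real (inscribed K A) := by
      rw [integral_add (hIint.const_mul ρ) hcst, integral_const_mul, setIntegral_const,
        copyIntegral,
        smul_eq_mul, mul_comm (B * R)]
    rw [← hrhs, copyIntegral]
    refine norm_integral_le_of_norm_le ((hIint.const_mul ρ).add hcst)
      (ae_restrict_of_forall_mem (isClosed_inscribed K A).measurableSet fun u hu => ?_)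
    have hw := ratioWeight_nonneg (n := n) hε.le (fillRatio_nonneg K A u)
    rw [norm_smul, Real.norm_of_nonneg hw, smul_eq_mul, mul_one]
    rcases lt_or_ge (1 - δ) (fillRatio K A u) with h | h
    · nlinarith [hnear u hu h, mul_nonneg hB hR]
    · nlinarith [mul_le_mul (hweight u hu h) (hfar u hu) (norm_nonneg _) hB, mul_nonneg hρ hw]
  have hscale : (copyIntegral K A (ratioWeight n ε) fun _ => (1 : ℝ)) •
      ((copyIntegral K A (ratioWeight n ε) fun _ => (1 : ℝ))⁻¹ •
        (copyIntegral K A (ratioWeight n ε) fun u => u.app x) - y)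
      = copyIntegral K A (ratioWeight n ε) (fun u => u.app x - y) := by
    rw [hdiff, smul_sub, smul_inv_smul₀ hIpos.ne']
  rw [← hscale, norm_smul, Real.norm_of_nonneg hIpos.le] at hbound
  exact hbound

theorem continuousAt_fittedPoint_smul_self {K : KBody n} {x : En n} (hx : x ∈ K.1)
    (hfix : ∀ g : AffG n, g • K = K → g x = x) (g₀ : AffG n) :
    ContinuousAt (fittedPoint K x) (g₀ • K) := by
  set A₀ := g₀ • K with hA₀
  set y := g₀ x with hy_def
  have hy : ∀ u ∈ inscribed K A₀, fillRatio K A₀ u = 1 → u.app x = y := by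
    intro u hu h
    obtain ⟨g, hg, happ⟩ := exists_smul_eq_of_fillRatio_eq_one hu h
    rw [← happ, ← fittedPoint_smul_self hfix g, hg, fittedPoint_smul_self hfix]
  have hyA : y ∈ A₀.1 := mem_image_of_mem g₀ hx
  obtain ⟨a, ha⟩ := A₀.2
  have hD := isCompact_shrink_preimage K A₀ a (s := 2⁻¹) (by norm_num)
  set D := {u : AMap n | u.shrink a 2⁻¹ ∈ inscribed K A₀}
  obtain ⟨R, hR⟩ := hD.exists_bound_of_continuousOn
    (((AMap.continuous_app x).sub continuous_const).continuousOn (f := fun u => u.app x - y))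
  rw [ContinuousAt, fittedPoint_smul_self hfix, Metric.tendsto_nhds]
  intro ρ hρ
  obtain ⟨δ, hδ, hnear⟩ := eventually_norm_app_sub_lt K A₀ hy (half_pos hρ) hx
  set B := δ⁻¹ ^ (Module.finrank ℝ (AMap n) + 1)
  have hB : 0 ≤ B := by positivity
  set m := (Measure.addHaar : Measure (AMap n)).real D
  obtain ⟨ε, hε, hM⟩ := exists_le_copyIntegral_ratioWeight K A₀
    (ofEquiv_mem_inscribed g₀ K) (fillRatio_ofEquiv g₀ K) (B * |R| * m / (ρ / 2) + 1)
  have hbig := (continuous_copyIntegral K (continuous_ratioWeight hε)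
    (continuous_const (y := (1 : ℝ)))).continuousAt.eventually
      (lt_mem_nhds ((lt_add_one _).trans_le hM))
  filter_upwards [hnear, hbig, eventually_shrink_inscribed K A₀ ha (s := 2⁻¹) (by norm_num)
    (by norm_num)] with A hAnear hAbig hAshrink
  by_cases hA : ∃ g : AffG n, g • K = A
  · obtain ⟨g, rfl⟩ := hA
    rw [fittedPoint_smul_self hfix, dist_eq_norm, ← AMap.app_ofEquiv g]
    refine (hAnear _ (ofEquiv_mem_inscribed g K) ?_).trans (half_lt_self hρ)
    rw [fillRatio_ofEquiv]
    linarith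
  rw [fittedPoint, dif_neg hA, dist_eq_norm]
  obtain ⟨ε', hε', hw⟩ := exists_ratioWeight_zero_eq hA
  rw [copyIntegral_congr hw, copyIntegral_congr hw]
  have hIpos := copyIntegral_ratioWeight_pos K A hε'
  have hmono : copyIntegral K A (ratioWeight n ε) (fun _ => (1 : ℝ))
      ≤ copyIntegral K A (ratioWeight n ε') fun _ => (1 : ℝ) := by
    refine setIntegral_mono_on (integrableOn_ratioWeight_smul K A hε continuous_const)
      (integrableOn_ratioWeight_smul K A hε' continuous_const)
      (isClosed_inscribed K A).measurableSet fun u hu => ?_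
    rw [← hw u hu, smul_eq_mul, smul_eq_mul, mul_one, mul_one]
    exact ratioWeight_le_ratioWeight_zero (fillRatio_nonneg K A u) (fillRatio_lt_one hA hu)
  have hvol : (Measure.addHaar : Measure (AMap n)).real (inscribed K A) ≤ m :=
    measureReal_mono (fun u hu => hAshrink.2.1 u hu) hD.measure_lt_top.ne
  have hest := norm_average_sub_le x y hε' (half_pos hρ).le (abs_nonneg R) hB
    (fun u hu h => (hAnear u hu h).le)
    (fun u hu => (hR u (hAshrink.2.1 u hu)).trans (le_abs_self R))
    (fun u hu h => hw u hu ▸ ratioWeight_zero_le hδ h)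
  set I := copyIntegral K A (ratioWeight n ε') fun _ => (1 : ℝ)
  have h1 : B * |R| * m < I * (ρ / 2) :=
    (div_lt_iff₀ (half_pos hρ)).1 (hAbig.trans_le hmono)
  have h2 : B * |R| * (Measure.addHaar : Measure (AMap n)).real (inscribed K A)
      ≤ B * |R| * m := by gcongr
  refine lt_of_mul_lt_mul_left ?_ hIpos.le
  linarith

theorem continuous_fittedPoint {K : KBody n} {x : En n} (hx : x ∈ K.1)
    (hfix : ∀ g : AffG n, g • K = K → g x = x) : Continuous (fittedPoint K x) := by
  refine continuous_iff_continuousAt.2 fun A => ?_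
  by_cases hA : ∃ g : AffG n, g • K = A
  · obtain ⟨g, rfl⟩ := hA
    exact continuousAt_fittedPoint_smul_self hx hfix g
  · exact continuousAt_fittedPoint_of_notMem_orbit x hA

end FittedPoint

/-- Proper version of Grünbaum's conjecture: if `x ∈ Int K` is fixed by all affine
symmetries of `K`, there is a proper affine invariant point `p` with `p K = x`. -/
theorem grunbaum_proper {n : ℕ} (K : KBody n) (x : En n)
    (hx : x ∈ interior (K.1 : Set (En n)))
    (hfix : ∀ g : AffG n, g • K = K → g x = x) :
    ∃ p : KBody n → En n, IsAffineInvariantPoint p ∧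
      (∀ A : KBody n, p A ∈ interior (A.1 : Set (En n))) ∧ p K = x := by
  refine ⟨fittedPoint K x, ⟨continuous_fittedPoint (interior_subset hx) hfix,
    fittedPoint_smul hfix⟩, fittedPoint_mem_interior hx hfix, ?_⟩
  simpa using fittedPoint_smul_self hfix 1

end
end
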